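/- arXiv:2308.09981 — 5 statements merged into one kernel-verified Lean document; each statement's English description precedes it below -/
import Mathlib

section
/- Let G be a non-abelian VZ-group. Then the number of non-linear irreducible complex characters of G equals |Z(G)| − |Z(G)/G'|. -/
/-- `χ` is an irreducible complex character of `G`. -/
def IsIrrChar (G : Type) [Group G] (χ : G → ℂ) : Prop :=
  ∃ V : FDRep ℂ G, CategoryTheory.Simple V ∧ FDRep.character V = χ

/-- `G` is a VZ-group: every non-linear irreducible complex character vanishes off the
center. -/
def IsVZ (G : Type) [Group G] : Prop :=
  ∀ χ : G → ℂ, IsIrrChar G χ → χ 1 ≠ 1 → ∀ g : G, g ∉ Subgroup.center G → χ g = 0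


open CategoryTheory

theorem vz_centralChar {G : Type} [Group G] [Fintype G] (V : FDRep ℂ G) [Simple V] :
    ∃ l : ↥(Subgroup.center G) →* ℂˣ,
      ∀ z : ↥(Subgroup.center G), V.ρ (z : G) = ((l z : ℂˣ) : ℂ) • (1 : V →ₗ[ℂ] V) := by
  classical
  have hpos : Module.finrank ℂ V ≠ 0 := by
    intro h
    have h1 := (FDRep.simple_iff_char_is_norm_one V).1 inferInstance
    have hs : Subsingleton V := Module.finrank_zero_iff.1 h
    have h0 : ∀ g, V.character g = 0 := fun g => by
      have : V.ρ g = 0 := Subsingleton.elim _ _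
      simp [FDRep.character, this]
    simp [h0] at h1
    exact Fintype.card_ne_zero (by exact_mod_cast h1.symm)
  have hex : ∀ z : ↥(Subgroup.center G), ∃ c : ℂ, V.ρ (z : G) = c • (1 : V →ₗ[ℂ] V) := by
    intro z
    let f : V ⟶ V := ⟨Action.ρ V (z : G), fun g => by
      have h := (Subgroup.mem_center_iff.1 z.2) g
      have h2 := congrArg (Action.ρ V) h
      rw [map_mul, map_mul] at h2
      exact h2.symm⟩
    obtain ⟨c, hc⟩ := endomorphism_simple_eq_smul_id ℂ f
    refine ⟨c, ?_⟩
    have h3 := congrArg (fun k : V ⟶ V => k.hom.hom.hom) hc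
    exact h3.symm
  choose c hc using hex
  have : Nontrivial V := Module.nontrivial_of_finrank_pos (R := ℂ) (Nat.pos_of_ne_zero hpos)
  obtain ⟨v, hv⟩ := exists_ne (0 : V)
  have inj : ∀ a b : ℂ, a • (1 : V →ₗ[ℂ] V) = b • (1 : V →ₗ[ℂ] V) → a = b := by
    intro a b h
    have := LinearMap.congr_fun h v
    exact smul_left_injective ℂ hv this
  let m : ↥(Subgroup.center G) →* ℂ :=
    { toFun := c
      map_one' := inj _ _ (by rw [← hc]; simp)
      map_mul' := fun x y => inj _ _ (by rw [← hc]; simp [hc, smul_smul, mul_comm]) }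
  exact ⟨m.toHomUnits, fun z => by rw [hc]; rfl⟩

noncomputable def vzDeg (G : Type) [Group G] : ℂ :=
  ((Real.sqrt (Nat.card G / Nat.card (Subgroup.center G)) : ℝ) : ℂ)

open Classical in
noncomputable def vzChi {G : Type} [Group G] (l : ↥(Subgroup.center G) →* ℂˣ) (g : G) : ℂ :=
  if h : g ∈ Subgroup.center G then vzDeg G * (l ⟨g, h⟩ : ℂˣ) else 0

theorem vz_sum {G : Type} [Group G] [Fintype G] (f : G → ℂ)
    (h : ∀ g, g ∉ Subgroup.center G → f g = 0) (c : ℂ) (hc : ∀ g ∈ Subgroup.center G, f g = c) :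
    ∑ g, f g = Nat.card (Subgroup.center G) * c := by
  classical
  have : ∀ g, f g = if g ∈ Subgroup.center G then c else 0 := by
    intro g; split_ifs with hg
    · exact hc g hg
    · exact h g hg
  simp_rw [this, ← Finset.sum_filter, Finset.sum_const, nsmul_eq_mul]
  congr 2
  rw [Nat.card_eq_fintype_card, Fintype.card_subtype]

theorem vz_char_center {G : Type} [Group G] (V : FDRep ℂ G)
    (l : ↥(Subgroup.center G) →* ℂˣ)
    (hl : ∀ z : ↥(Subgroup.center G), V.ρ (z : G) = ((l z : ℂˣ) : ℂ) • (1 : V →ₗ[ℂ] V)) (z : ↥(Subgroup.center G)) :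
    V.character z = Module.finrank ℂ V * (l z : ℂˣ) := by
  rw [FDRep.character, hl, map_smul, LinearMap.trace_one, smul_eq_mul, mul_comm]

theorem vz_norm {G : Type} [Group G] [Fintype G] (hVZ : IsVZ G) (V : FDRep ℂ G) [Simple V]
    (hn : V.character 1 ≠ 1) (l : ↥(Subgroup.center G) →* ℂˣ)
    (hl : ∀ z : ↥(Subgroup.center G), V.ρ (z : G) = ((l z : ℂˣ) : ℂ) • (1 : V →ₗ[ℂ] V)) :
    (Nat.card (Subgroup.center G) : ℂ) * (Module.finrank ℂ V) ^ 2 = Nat.card G := by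
  have h1 := (FDRep.simple_iff_char_is_norm_one V).1 inferInstance
  rw [← h1]
  symm
  apply vz_sum
  · intro g hg
    rw [hVZ _ ⟨V, inferInstance, rfl⟩ hn g hg, zero_mul]
  · intro g hg
    have ha := vz_char_center V l hl ⟨g, hg⟩
    have hb := vz_char_center V l hl ⟨g, hg⟩⁻¹
    have hb' : V.character g⁻¹ = Module.finrank ℂ V * (l ⟨g, hg⟩⁻¹ : ℂˣ) := hb
    rw [ha, hb', map_inv]
    have : ((l ⟨g, hg⟩ : ℂˣ) : ℂ) * ((l ⟨g, hg⟩)⁻¹ : ℂˣ) = 1 := by simp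
    linear_combination (Module.finrank ℂ V : ℂ) ^ 2 * this

theorem vz_char_eq {G : Type} [Group G] [Fintype G] (hVZ : IsVZ G) (V : FDRep ℂ G) [Simple V]
    (hn : V.character 1 ≠ 1) (l : ↥(Subgroup.center G) →* ℂˣ)
    (hl : ∀ z : ↥(Subgroup.center G), V.ρ (z : G) = ((l z : ℂˣ) : ℂ) • (1 : V →ₗ[ℂ] V)) :
    V.character = vzChi l := by
  have hd : (Module.finrank ℂ V : ℂ) = vzDeg G := by
    have h := vz_norm hVZ V hn l hl
    have h' : (Nat.card (Subgroup.center G) : ℝ) * (Module.finrank ℂ V) ^ 2 = Nat.card G := by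
      exact_mod_cast h
    have hz : (Nat.card (Subgroup.center G) : ℝ) ≠ 0 := by
      exact_mod_cast Nat.card_pos.ne'
    rw [vzDeg, ← h', mul_div_cancel_left₀ _ hz, Real.sqrt_sq (by positivity)]
    simp
  funext g
  unfold vzChi
  split_ifs with h
  · rw [← hd]; exact vz_char_center V l hl ⟨g, h⟩
  · exact hVZ _ ⟨V, inferInstance, rfl⟩ hn g h

theorem vz_chi_inj {G : Type} [Group G] [Fintype G] :
    Function.Injective (vzChi (G := G)) := by
  intro l m h
  have hd : vzDeg G ≠ 0 := by
    have h1 : 0 < Nat.card G := Nat.card_pos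
    have h2 : 0 < Nat.card (Subgroup.center G) := Nat.card_pos
    unfold vzDeg
    rw [Complex.ofReal_ne_zero]
    positivity
  ext z
  have := congrFun h z
  simp only [vzChi, z.2, dif_pos] at this
  exact mul_left_cancel₀ hd this

theorem vz_extend {G : Type} [Group G] [Fintype G] (l : ↥(Subgroup.center G) →* ℂˣ)
    (hl : ∀ z : ↥(Subgroup.center G), (z : G) ∈ commutator G → l z = 1) :
    ∃ m : G →* ℂˣ, ∀ z : ↥(Subgroup.center G), m z = l z := by
  let f : ↥(Subgroup.center G) →* Abelianization G :=
    Abelianization.of.comp (Subgroup.center G).subtype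
  have hk : f.rangeRestrict.ker ≤ l.ker := by
    intro z hz
    rw [MonoidHom.ker_rangeRestrict, MonoidHom.mem_ker] at hz
    apply hl
    rw [← Abelianization.ker_of]
    exact hz
  let l' := f.rangeRestrict.liftOfSurjective f.rangeRestrict_surjective ⟨l, hk⟩
  have : Finite (Abelianization G) := inferInstanceAs (Finite (G ⧸ _))
  have : NeZero (Monoid.exponent (Abelianization G)) :=
    ⟨Monoid.exponent_ne_zero_of_finite⟩
  have : NeZero ((Monoid.exponent (Abelianization G) : ℕ) : ℂ) := inferInstance
  obtain ⟨m, hm⟩ := MonoidHom.domRestrict_surjective (M := ℂ) f.range l'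
  refine ⟨m.comp Abelianization.of, fun z => ?_⟩
  have h1 := DFunLike.congr_fun hm (f.rangeRestrict z)
  have h2 : l' (f.rangeRestrict z) = l z :=
    MonoidHom.liftOfRightInverse_comp_apply _ _ _ ⟨l, hk⟩ z
  rw [h2] at h1
  exact h1

theorem vz_nontriv {G : Type} [Group G] [Fintype G] (hVZ : IsVZ G) (V : FDRep ℂ G) [Simple V]
    (hn : V.character 1 ≠ 1) (l : ↥(Subgroup.center G) →* ℂˣ)
    (hl : ∀ z : ↥(Subgroup.center G), V.ρ (z : G) = ((l z : ℂˣ) : ℂ) • (1 : V →ₗ[ℂ] V))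
    (ht : ∀ z : ↥(Subgroup.center G), (z : G) ∈ commutator G → l z = 1) : False := by
  classical
  obtain ⟨m, hm⟩ := vz_extend l ht
  let r : Representation ℂ G ℂ :=
    (Module.toModuleEnd ℂ (S := ℂ) ℂ).toMonoidHom.comp ((Units.coeHom ℂ).comp m)
  let W : FDRep ℂ G := FDRep.of r
  have hW : ∀ g, W.character g = m g := by
    intro g
    have : W.ρ g = ((m g : ℂˣ) : ℂ) • (1 : ℂ →ₗ[ℂ] ℂ) := by
      ext; rfl
    rw [FDRep.character, this]
    have h2 := LinearMap.trace_one ℂ ℂ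
    rw [map_smul]
    erw [h2]
    simp
  have hWs : Simple W := by
    rw [FDRep.simple_iff_char_is_norm_one]
    simp [hW]
  have hinv : Invertible (Nat.card G : ℂ) :=
    invertibleOfNonzero (by exact_mod_cast Nat.card_pos.ne')
  have ho := FDRep.char_orthonormal V W
  have hS : ∑ g : G, V.character g * W.character g⁻¹
      = Nat.card (Subgroup.center G) * Module.finrank ℂ V := by
    apply vz_sum
    · intro g hg
      rw [hVZ _ ⟨V, inferInstance, rfl⟩ hn g hg, zero_mul]
    · intro g hg
      have ha : V.character g = _ := vz_char_center V l hl ⟨g, hg⟩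
      rw [ha, hW, map_inv, ← hm]
      simp
  have hnorm := vz_norm hVZ V hn l hl
  have hG : (Nat.card G : ℂ) ≠ 0 := by exact_mod_cast Nat.card_pos.ne'
  split_ifs at ho with hi
  · obtain ⟨i⟩ := hi
    apply hn
    rw [FDRep.char_iso i, hW]; simp
  · rw [hS] at ho
    have : (Nat.card (Subgroup.center G) : ℂ) * Module.finrank ℂ V = 0 := by
      simpa [hG] using ho
    apply hG
    rw [← hnorm, pow_two, ← mul_assoc, this, zero_mul]

open scoped MonoidAlgebra in
theorem vz_ofSimple {G : Type} [Group G] [Fintype G] (S : Type) [AddCommGroup S]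
    [Module ℂ[G] S] [IsSimpleModule ℂ[G] S] :
    ∃ V : FDRep ℂ G, Simple V ∧ ∀ (g : G) (c : ℂ),
      (∀ x : S, MonoidAlgebra.single g (1:ℂ) • x = algebraMap ℂ ℂ[G] c • x) →
      V.ρ g = c • (1 : V →ₗ[ℂ] V) := by
  have : NeZero (Nat.card G : ℂ) := ⟨by exact_mod_cast Nat.card_pos.ne'⟩
  let _ : Module ℂ S := Module.compHom S (algebraMap ℂ ℂ[G])
  have hst : IsScalarTower ℂ ℂ[G] S := ⟨fun a b x => by
    rw [Algebra.smul_def, mul_smul]; rfl⟩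
  have hfin : FiniteDimensional ℂ S := by
    have : Module.Finite ℂ ℂ[G] := inferInstance
    have : Module.Finite ℂ[G] S := inferInstance
    exact Module.Finite.trans ℂ[G] S
  let ρ : Representation ℂ G S := Representation.ofModule' (k := ℂ) (G := G) S
  have hρ : ∀ g x, ρ g x = MonoidAlgebra.single g (1:ℂ) • x := fun g x => by
    simp [ρ, Representation.ofModule']
  have hirr : ρ.IsIrreducible :=
    (Representation.isSimpleModule_iff_irreducible_ofModule (k := ℂ) (G := G) S).1 inferInstance
  refine ⟨FDRep.of ρ, ?_, ?_⟩
  · rw [FDRep.simple_iff_char_is_norm_one]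
    have hinv : Invertible (Nat.card G : ℂ) := invertibleOfNonzero (NeZero.ne _)
    have h := Representation.char_orthonormal ρ ρ
    rw [if_pos ⟨Representation.Equiv.refl ρ⟩] at h
    have h3 := (inv_mul_eq_one₀ (NeZero.ne (Nat.card G : ℂ))).1 h
    exact h3.symm
  · intro g c h
    refine LinearMap.ext fun x => ?_
    exact (hρ g x).trans (h x)

open scoped MonoidAlgebra in
theorem vz_exists {G : Type} [Group G] [Fintype G] (l : ↥(Subgroup.center G) →* ℂˣ) :
    ∃ V : FDRep ℂ G, Simple V ∧
      ∀ z : ↥(Subgroup.center G), V.ρ (z : G) = ((l z : ℂˣ) : ℂ) • (1 : V →ₗ[ℂ] V) := by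
  classical
  let A := ℂ[G]
  have hcomm : ∀ (z : ↥(Subgroup.center G)) (a : ℂ[G]),
      a * MonoidAlgebra.single (z : G) (1:ℂ) = MonoidAlgebra.single (z : G) (1:ℂ) * a := by
    intro z a
    induction a using MonoidAlgebra.induction_on with
    | of g =>
      simp [MonoidAlgebra.of_apply, MonoidAlgebra.single_mul_single,
        (Subgroup.mem_center_iff.1 z.2) g]
    | add x y hx hy => rw [add_mul, mul_add, hx, hy]
    | smul r x hx => rw [smul_mul_assoc, mul_smul_comm, hx]
  let M : Submodule ℂ[G] ℂ[G] :=
    { carrier := {x | ∀ z : ↥(Subgroup.center G),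
        MonoidAlgebra.single (z : G) (1:ℂ) * x = ((l z : ℂˣ) : ℂ) • x}
      add_mem' := fun {a b} ha hb z => by rw [mul_add, ha, hb, smul_add]
      zero_mem' := fun z => by simp
      smul_mem' := fun a x hx z => by
        rw [smul_eq_mul, ← mul_assoc, ← hcomm, mul_assoc, hx z, mul_smul_comm] }
  let e : ℂ[G] := ∑ z : ↥(Subgroup.center G),
    MonoidAlgebra.single (z : G) (((l z)⁻¹ : ℂˣ) : ℂ)
  have heM : e ∈ M := by
    intro z
    simp only [e, Finset.mul_sum, Finset.smul_sum]
    refine Fintype.sum_equiv (Equiv.mulLeft z) _ _ fun w => ?_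
    simp only [MonoidAlgebra.single_mul_single, MonoidAlgebra.smul_single, Equiv.coe_mulLeft,
      map_mul, smul_eq_mul, Subgroup.coe_mul, one_mul]
    congr 1
    simp
    field_simp
  have he0 : e ≠ 0 := by
    intro h
    have h1 : MonoidAlgebra.lift ℂ ℂ G (1 : G →* ℂ) e = 0 := by rw [h, map_zero]
    have h2 := congrArg (fun x : ℂ[G] => x.coeff 1) h
    simp [e, Finsupp.single_apply] at h2
  have : Nontrivial M := ⟨⟨⟨e, heM⟩, 0, fun h => he0 (congrArg Subtype.val h)⟩⟩
  have : NeZero (Nat.card G : ℂ) := ⟨by exact_mod_cast Nat.card_pos.ne'⟩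
  obtain ⟨S, hS⟩ := IsSemisimpleModule.exists_simple_submodule ℂ[G] M
  obtain ⟨V, hV, h⟩ := vz_ofSimple (G := G) S
  refine ⟨V, hV, fun z => h z _ fun x => ?_⟩
  apply Subtype.ext
  apply Subtype.ext
  have hx := x.1.2 z
  refine hx.trans ?_
  rw [Algebra.smul_def]
  rfl

theorem vz_nonlin {G : Type} [Group G] (V : FDRep ℂ G) (l : ↥(Subgroup.center G) →* ℂˣ)
    (hl : ∀ z : ↥(Subgroup.center G), V.ρ (z : G) = ((l z : ℂˣ) : ℂ) • (1 : V →ₗ[ℂ] V)) (h1 : V.character 1 = 1)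
    (z : ↥(Subgroup.center G)) (hz : (z : G) ∈ commutator G) : l z = 1 := by
  have hf : Module.finrank ℂ V = 1 := by
    rw [FDRep.char_one] at h1; exact_mod_cast h1
  let d : G →* ℂ := (LinearMap.det (M := V) (A := ℂ)).comp V.ρ
  have hd : d.toHomUnits (z : G) = 1 :=
    Abelianization.commutator_subset_ker d.toHomUnits hz
  have h2 : d (z : G) = 1 := congrArg Units.val hd
  ext
  rw [Units.val_one, ← h2]
  simp [d, hl, LinearMap.det_smul, hf]

theorem vz_count (A : Type) [CommGroup A] [Finite A] (H : Subgroup A) :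
    {l : A →* ℂˣ | ¬ ∀ z ∈ H, l z = 1}.ncard = Nat.card A - Nat.card (A ⧸ H) := by
  have : NeZero (Monoid.exponent A) := ⟨Monoid.exponent_ne_zero_of_finite⟩
  have : NeZero ((Monoid.exponent A : ℕ) : ℂ) := inferInstance
  have hc1 := CommGroup.card_domRestrictHom_ker (G := A) ℂ H
  have hc2 := CommGroup.card_monoidHom_of_hasEnoughRootsOfUnity A ℂ
  have hfin : Finite (A →* ℂˣ) :=
    Nat.finite_of_card_ne_zero (by rw [hc2]; exact Nat.card_pos.ne')
  rw [← hc1, ← hc2]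
  have : {l : A →* ℂˣ | ¬ ∀ z ∈ H, l z = 1} =
      ((MonoidHom.domRestrictHom H ℂˣ).ker : Set (A →* ℂˣ))ᶜ := by
    ext l
    rw [Set.mem_compl_iff, Set.mem_ofPred_eq, not_iff_not, SetLike.mem_coe, MonoidHom.mem_ker]
    constructor
    · intro h
      exact MonoidHom.ext fun z => h z.1 z.2
    · intro h z hz
      exact DFunLike.congr_fun h (⟨z, hz⟩ : H)
  rw [this, Set.ncard_compl]
  rfl

/-- A non-abelian VZ-group has exactly `|Z(G)| - |Z(G)/G'|` non-linear irreducible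
complex characters. -/
theorem stmt5 {G : Type} [Group G] [Fintype G] (hVZ : IsVZ G)
    (hnab : ¬ ∀ a b : G, a * b = b * a) :
    Nat.card {χ : G → ℂ // IsIrrChar G χ ∧ χ 1 ≠ 1} =
      Nat.card ↥(Subgroup.center G) -
        Nat.card (↥(Subgroup.center G) ⧸ (commutator G).subgroupOf (Subgroup.center G)) := by
  let _ : CommGroup ↥(Subgroup.center G) :=
    { (inferInstance : Group ↥(Subgroup.center G)) with
      mul_comm := fun a b => Subtype.ext ((Subgroup.mem_center_iff.1 b.2) a.1) }
  have hcount := vz_count ↥(Subgroup.center G) ((commutator G).subgroupOf (Subgroup.center G))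
  refine Eq.trans ?_ hcount
  have hbij : Set.BijOn (vzChi (G := G))
      {l | ¬ ∀ z ∈ (commutator G).subgroupOf (Subgroup.center G), l z = 1}
      {χ | IsIrrChar G χ ∧ χ 1 ≠ 1} := by
    refine ⟨?_, vz_chi_inj.injOn, ?_⟩
    · intro l hlK
      obtain ⟨V, hV, hl⟩ := vz_exists l
      have hn : V.character 1 ≠ 1 := fun h1 =>
        hlK fun z hz => vz_nonlin V l hl h1 z hz
      rw [← vz_char_eq hVZ V hn l hl]
      exact ⟨⟨V, hV, rfl⟩, hn⟩
    · rintro χ ⟨⟨V, hV, rfl⟩, hn⟩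
      obtain ⟨l, hl⟩ := vz_centralChar V
      exact ⟨l, fun h => vz_nontriv hVZ V hn l hl fun z hz => h z hz,
        (vz_char_eq hVZ V hn l hl).symm⟩
  exact hbij.ncard_eq.symm
end

section
/- Let G be a VZ-group with cyclic center Z(G). If H is a subgroup of G of index |G/Z(G)|^{1/2} and ψ is a linear character of H with ψ^G a non-linear irreducible character of G, then H is abelian. -/
open Classical in
/-- The induced character `ψ^G` of a character `ψ` of a subgroup `H ≤ G`. -/
noncomputable def inducedChar {G : Type} [Group G] [Fintype G] (H : Subgroup G)
    (ψ : ↥H → ℂ) : G → ℂ :=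
  fun g => (Nat.card ↥H : ℂ)⁻¹ *
    ∑ x : G, if h : x * g * x⁻¹ ∈ H then ψ ⟨x * g * x⁻¹, h⟩ else 0

open scoped commutatorElement

open CategoryTheory in
lemma vz_schur {G : Type} [Group G] (V : FDRep ℂ G) [Simple V] (T : V →ₗ[ℂ] V)
    (hT : ∀ g, T ∘ₗ V.ρ g = V.ρ g ∘ₗ T) : ∃ c : ℂ, T = c • LinearMap.id := by
  let f : V ⟶ V := ⟨InducedCategory.homMk (ModuleCat.ofHom T), fun g => by
    ext1
    ext v
    exact LinearMap.congr_fun (hT g) v⟩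
  obtain ⟨c, hc⟩ := endomorphism_simple_eq_smul_id ℂ f
  refine ⟨c, ?_⟩
  have h2 := congrArg (fun f : V ⟶ V => f.hom.hom.hom) hc
  exact h2.symm

lemma vz_simple {G : Type} [Group G] [Fintype G] {V : Type} [AddCommGroup V] [Module ℂ V]
    [FiniteDimensional ℂ V] (ρ : Representation ℂ G V) [ρ.IsIrreducible] :
    CategoryTheory.Simple (FDRep.of ρ) := by
  have : Invertible (Nat.card G : ℂ) := invertibleOfNonzero (by simp)
  rw [FDRep.simple_iff_char_is_norm_one]
  have h := Representation.char_orthonormal ρ ρ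
  rw [if_pos ⟨Representation.Equiv.refl ρ⟩] at h
  have h0 : (Nat.card G : ℂ) ≠ 0 := by simp
  rw [inv_mul_eq_one₀ h0] at h
  exact h.symm

lemma vz_sum_zero {G : Type} [Group G] [Fintype G] (V : FDRep ℂ G) [CategoryTheory.Simple V]
    (hV : V.character 1 ≠ 0) (g : G) (hg : V.character g = 0) :
    ∑ x : G, V.ρ (x * g * x⁻¹) = 0 := by
  obtain ⟨c, hc⟩ := vz_schur V (∑ x : G, V.ρ (x * g * x⁻¹)) (by
    intro k
    change (∑ x : G, V.ρ (x * g * x⁻¹)) * V.ρ k = V.ρ k * ∑ x : G, V.ρ (x * g * x⁻¹)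
    rw [Finset.sum_mul, Finset.mul_sum]
    refine (Fintype.sum_equiv (Equiv.mulLeft k) _ _ fun x => ?_).symm
    simp only [← map_mul, Equiv.coe_mulLeft]
    congr 1
    group)
  have ht := congrArg (LinearMap.trace ℂ V) hc
  have h1 : LinearMap.trace ℂ V (∑ x : G, V.ρ (x * g * x⁻¹)) = 0 := by
    rw [map_sum]
    refine Finset.sum_eq_zero fun x _ => ?_
    have := FDRep.char_conj V g x
    rw [hg] at this
    exact this
  have h2 : LinearMap.trace ℂ V LinearMap.id = V.character 1 := by
    simp [FDRep.char_one]
  rw [h1, map_smul, h2, smul_eq_mul] at ht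
  have : c = 0 := by
    rcases mul_eq_zero.1 ht.symm with h | h
    · exact h
    · exact absurd h hV
  rw [hc, this, zero_smul]

lemma vz_one_dim {V : Type} [AddCommGroup V] [Module ℂ V] [FiniteDimensional ℂ V]
    (h : Module.finrank ℂ V = 1) (S T : V →ₗ[ℂ] V) : S * T = T * S := by
  obtain ⟨v, hv, hs⟩ := finrank_eq_one_iff'.1 h
  obtain ⟨s, hs1⟩ := hs (S v)
  obtain ⟨t, ht1⟩ := hs (T v)
  ext w
  obtain ⟨a, rfl⟩ := hs w
  simp only [Module.End.mul_apply, map_smul, ← hs1, ← ht1]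
  rw [smul_comm s t]

lemma vz_module {G : Type} [Group G] [Fintype G] (a : MonoidAlgebra ℂ G)
    (hrep : ∀ (V : Type) [AddCommGroup V] [Module ℂ V] [FiniteDimensional ℂ V]
      (ρ : Representation ℂ G V) [ρ.IsIrreducible], ρ.asAlgebraHom a = 0)
    (M : Type) [AddCommGroup M] [Module ℂ M] [Module (MonoidAlgebra ℂ G) M]
    [IsScalarTower ℂ (MonoidAlgebra ℂ G) M]
    [hsm : IsSimpleModule (MonoidAlgebra ℂ G) M] (v : M) : a • v = 0 := by
  have : FiniteDimensional ℂ M := by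
    have : Module.Finite ℂ (MonoidAlgebra ℂ G) :=
      Module.Finite.equiv (MonoidAlgebra.coeffLinearEquiv ℂ).symm
    exact Module.Finite.trans (MonoidAlgebra ℂ G) _
  let ρ : Representation ℂ G M := Representation.ofModule' M
  have hρ : ρ.asAlgebraHom = Algebra.lsmul ℂ ℂ M :=
    (MonoidAlgebra.lift ℂ (M →ₗ[ℂ] M) G).apply_symm_apply _
  let e : ρ.asModule ≃ₗ[MonoidAlgebra ℂ G] M :=
    { ρ.asModuleEquiv.toAddEquiv with
      map_smul' := fun r x => by
        have := ρ.asModuleEquiv_map_smul r x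
        rw [hρ] at this
        exact this }
  have hirr : ρ.IsIrreducible := by
    rw [Representation.irreducible_iff_isSimpleModule_asModule]
    exact IsSimpleModule.congr e
  have h1 := LinearMap.congr_fun (hrep M ρ) v
  rw [hρ] at h1
  exact h1

lemma vz_alg_zero {G : Type} [Group G] [Fintype G] (hVZ : IsVZ G) (g : G)
    (hg : g ∉ Subgroup.center G) (h k : G) :
    (∑ x : G, MonoidAlgebra.of ℂ G (x * g * x⁻¹)) *
      (MonoidAlgebra.of ℂ G (h * k) - MonoidAlgebra.of ℂ G (k * h)) = 0 := by
  have hrep : ∀ (V : Type) [AddCommGroup V] [Module ℂ V] [FiniteDimensional ℂ V]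
      (ρ : Representation ℂ G V) [ρ.IsIrreducible],
      ρ.asAlgebraHom ((∑ x : G, MonoidAlgebra.of ℂ G (x * g * x⁻¹)) *
      (MonoidAlgebra.of ℂ G (h * k) - MonoidAlgebra.of ℂ G (k * h))) = 0 := by
    intro V _ _ _ ρ _
    have hs := vz_simple ρ
    rw [map_mul, map_sub, map_sum]
    simp only [Representation.asAlgebraHom_of]
    by_cases h1 : (FDRep.of ρ).character 1 = 1
    · have : Module.finrank ℂ V = 1 := by
        rw [FDRep.char_one] at h1
        exact_mod_cast h1
      rw [map_mul, map_mul, vz_one_dim this (ρ h) (ρ k), sub_self, mul_zero]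
    · have h2 := hVZ _ ⟨_, hs, rfl⟩ h1 g hg
      have h3 : (FDRep.of ρ).character 1 ≠ 0 := by
        intro h0
        rw [FDRep.char_one] at h0
        have h0' : Module.finrank ℂ V = 0 := by exact_mod_cast h0
        have : Subsingleton V := Module.finrank_zero_iff.1 h0'
        have hi : CategoryTheory.CategoryStruct.id (FDRep.of ρ) = 0 := by
          ext v
          exact Subsingleton.elim (α := V) _ _
        exact CategoryTheory.id_nonzero _ hi
      have h4 : ∑ x : G, ρ (x * g * x⁻¹) = 0 := vz_sum_zero (FDRep.of ρ) h3 g h2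
      rw [h4, zero_mul]
  generalize (∑ x : G, MonoidAlgebra.of ℂ G (x * g * x⁻¹)) *
      (MonoidAlgebra.of ℂ G (h * k) - MonoidAlgebra.of ℂ G (k * h)) = a at hrep
  have hJ := IsSemisimpleRing.jacobson_eq_bot (MonoidAlgebra ℂ G)
  have : a ∈ Ring.jacobson (MonoidAlgebra ℂ G) := by
    refine (Submodule.mem_sInf).2 ?_
    intro m hm
    have hsm : IsSimpleModule (MonoidAlgebra ℂ G) (MonoidAlgebra ℂ G ⧸ m) :=
      isSimpleModule_iff_isCoatom.2 hm
    have h1 := vz_module a hrep (MonoidAlgebra ℂ G ⧸ m) (Submodule.Quotient.mk 1)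
    rw [← Submodule.Quotient.mk_smul, Submodule.Quotient.mk_eq_zero] at h1
    simpa using h1
  rw [hJ] at this
  simpa using this

lemma vz_conj {G : Type} [Group G] [Fintype G] (hVZ : IsVZ G) (g : G)
    (hg : g ∉ Subgroup.center G) (h k : G) :
    ∃ x : G, x * g * x⁻¹ = g * ⁅h, k⁆ := by
  classical
  have H := vz_alg_zero hVZ g hg h k
  rw [mul_sub, sub_eq_zero, Finset.sum_mul, Finset.sum_mul] at H
  have H2 := congrArg (fun f : MonoidAlgebra ℂ G => f.coeff (g * (h * k))) H
  simp only [MonoidAlgebra.of_apply, MonoidAlgebra.single_mul_single, mul_one, MonoidAlgebra.coeff_sum,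
    Finsupp.finsetSum_apply, MonoidAlgebra.coeff_single, Finsupp.single_apply] at H2
  by_contra hx
  push Not at hx
  rw [Finset.sum_eq_zero (f := fun x => if x * g * x⁻¹ * (k * h) = g * (h * k) then (1 : ℂ) else 0)
    (fun x _ => if_neg fun e => hx x (by
      rw [eq_mul_inv_of_mul_eq e, commutatorElement_def]; group))] at H2
  rw [Finset.sum_boole, Nat.cast_eq_zero, Finset.card_eq_zero, Finset.filter_eq_empty_iff] at H2
  exact H2 (Finset.mem_univ 1) (by simp)

lemma vz_central {G : Type} [Group G] [Fintype G] (hVZ : IsVZ G) (h k : G) :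
    ⁅h, k⁆ ∈ Subgroup.center G := by
  by_contra hc
  have hc' : (⁅h, k⁆)⁻¹ ∉ Subgroup.center G := fun h' => hc (by simpa using inv_mem h')
  obtain ⟨x, hx⟩ := vz_conj hVZ _ hc' h k
  rw [inv_mul_cancel] at hx
  have : (⁅h, k⁆)⁻¹ = 1 := by simpa using hx
  exact hc' (this ▸ one_mem _)

lemma vz_exponent {G : Type} [Group G] [Fintype G] (hVZ : IsVZ G)
    (hn : ∃ x : G, x ∉ Subgroup.center G) :
    ∃ p : ℕ, p.Prime ∧ ∀ h k : G, ⁅h, k⁆ ^ p = 1 := by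
  obtain ⟨x, hx⟩ := hn
  let q : G ⧸ Subgroup.center G := QuotientGroup.mk x
  have hq : q ≠ 1 := fun h => hx ((QuotientGroup.eq_one_iff x).1 h)
  have ho : orderOf q ≠ 1 := fun h => hq (orderOf_eq_one_iff.1 h)
  obtain ⟨p, hp, hpd⟩ := Nat.exists_prime_and_dvd ho
  refine ⟨p, hp, fun h k => ?_⟩
  obtain ⟨n, hn⟩ := hpd
  have hopos : 0 < orderOf q := orderOf_pos q
  have hg : x ^ n ∉ Subgroup.center G := by
    intro hc
    have h1 : q ^ n = 1 := (QuotientGroup.eq_one_iff (x ^ n)).2 hc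
    have h2 := Nat.le_of_dvd (by rcases Nat.eq_zero_or_pos n with h | h
                                 · rw [h] at hn; omega
                                 · exact h) (orderOf_dvd_of_pow_eq_one h1)
    have := hp.two_le
    nlinarith
  have hgp : (x ^ n) ^ p ∈ Subgroup.center G := by
    rw [← pow_mul, mul_comm, ← hn]
    exact (QuotientGroup.eq_one_iff _).1 (pow_orderOf_eq_one q)
  obtain ⟨y, hy⟩ := vz_conj hVZ _ hg h k
  generalize x ^ n = g at *
  have hz := vz_central hVZ h k
  generalize ⁅h, k⁆ = z at *
  have hcomm : Commute g z := Subgroup.mem_center_iff.1 hz g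
  have h3 : (y * g * y⁻¹) ^ p = g ^ p := by
    rw [conj_pow, Subgroup.mem_center_iff.1 hgp y]; group
  rw [hy, hcomm.mul_pow] at h3
  simpa using h3

lemma vz_mem_zpowers {G : Type} [Group G] [Fintype G] (hVZ : IsVZ G)
    (hcyc : IsCyclic ↥(Subgroup.center G)) (x y : G) (hxy : ⁅x, y⁆ ≠ 1) (h k : G) :
    ⁅h, k⁆ ∈ Subgroup.zpowers ⁅x, y⁆ := by
  classical
  have hx : x ∉ Subgroup.center G := fun hx => hxy (by
    rw [commutatorElement_eq_one_iff_mul_comm]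
    exact (Subgroup.mem_center_iff.1 hx y).symm)
  obtain ⟨p, hp, hpe⟩ := vz_exponent hVZ ⟨x, hx⟩
  let c : Subgroup.center G := ⟨⁅x, y⁆, vz_central hVZ x y⟩
  let z : Subgroup.center G := ⟨⁅h, k⁆, vz_central hVZ h k⟩
  have hcp : c ^ p = 1 := Subtype.ext (hpe x y)
  have hzp : z ^ p = 1 := Subtype.ext (hpe h k)
  have hc1 : c ≠ 1 := fun e => hxy (congrArg Subtype.val e)
  have hoc : orderOf c = p := orderOf_eq_prime hcp hc1 (hp := ⟨hp⟩)
  have hcard := IsCyclic.card_pow_eq_one_le (α := Subgroup.center G) hp.pos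
  have hsub : (Subgroup.zpowers c : Set (Subgroup.center G)).toFinset ⊆
      Finset.univ.filter (fun a : Subgroup.center G => a ^ p = 1) := by
    intro a ha
    simp only [Set.mem_toFinset, SetLike.mem_coe] at ha
    obtain ⟨i, rfl⟩ := ha
    simp only [Finset.mem_filter, Finset.mem_univ, true_and]
    rw [← zpow_natCast, ← zpow_mul, mul_comm, zpow_mul, zpow_natCast, hcp, one_zpow]
  have heq := Finset.eq_of_subset_of_card_le hsub (by
    refine hcard.trans ?_
    rw [Set.toFinset_card]
    have := Fintype.card_zpowers (x := c)
    rw [hoc] at this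
    exact this.ge)
  have hzm : z ∈ (Subgroup.zpowers c : Set (Subgroup.center G)).toFinset := by
    rw [heq]; simp [hzp]
  simp only [Set.mem_toFinset, SetLike.mem_coe] at hzm
  obtain ⟨i, hi⟩ := hzm
  exact ⟨i, by simpa [c, z] using congrArg Subtype.val hi⟩

theorem stmt9 {G : Type} [Group G] [Fintype G] (hVZ : IsVZ G)
    (hcyc : IsCyclic ↥(Subgroup.center G))
    {m : ℕ} (hm : m ^ 2 = (Subgroup.center G).index)
    (H : Subgroup G) (hH : H.index = m) (ψ : ↥H →* ℂ)
    (hirr : IsIrrChar G (inducedChar H ⇑ψ)) (hnl : inducedChar H ⇑ψ 1 ≠ 1) :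
    ∀ x ∈ H, ∀ y ∈ H, x * y = y * x := by
  intro x hxH y hyH
  by_contra hne
  have hxy : ⁅x, y⁆ ≠ 1 := fun h => hne (commutatorElement_eq_one_iff_mul_comm.1 h)
  have hx : x ∉ Subgroup.center G := fun hx => hne (Subgroup.mem_center_iff.1 hx y).symm
  have hcH : ⁅x, y⁆ ∈ H := by
    rw [commutatorElement_def]
    exact H.mul_mem (H.mul_mem (H.mul_mem hxH hyH) (H.inv_mem hxH)) (H.inv_mem hyH)
  have hcZ := vz_central hVZ x y
  have hψ : ψ ⟨⁅x, y⁆, hcH⟩ = 1 := by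
    let a : H := ⟨x, hxH⟩
    let b : H := ⟨y, hyH⟩
    have e : (⟨⁅x, y⁆, hcH⟩ : H) = a * b * a⁻¹ * b⁻¹ := rfl
    have ha : ψ a * ψ a⁻¹ = 1 := by rw [← map_mul]; simp
    have hb : ψ b * ψ b⁻¹ = 1 := by rw [← map_mul]; simp
    rw [e, map_mul, map_mul, map_mul]
    linear_combination ψ b * ψ b⁻¹ * ha + hb
  have hχc : inducedChar H ψ ⁅x, y⁆ = inducedChar H ψ 1 := by
    unfold inducedChar
    congr 1
    refine Finset.sum_congr rfl fun t _ => ?_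
    have e : t * ⁅x, y⁆ * t⁻¹ = ⁅x, y⁆ := by
      rw [Subgroup.mem_center_iff.1 hcZ t]; group
    have e1 : t * 1 * t⁻¹ = 1 := by group
    rw [dif_pos (e.symm ▸ hcH), dif_pos (e1.symm ▸ H.one_mem)]
    simp only [e, e1]
    rw [hψ]
    exact (map_one ψ).symm
  have hχ1 : inducedChar H ψ 1 ≠ 0 := by
    have : inducedChar H ψ 1 = (Nat.card H : ℂ)⁻¹ * Fintype.card G := by
      unfold inducedChar
      congr 1
      rw [Finset.sum_congr rfl (g := fun _ => (1 : ℂ))]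
      · simp
      · intro t _
        have e1 : t * 1 * t⁻¹ = 1 := by group
        rw [dif_pos (e1.symm ▸ H.one_mem)]
        simp only [e1]
        exact map_one ψ
    rw [this]
    have hn : Nat.card H ≠ 0 := Nat.card_pos.ne'
    simp [hn]
  have hχx := hVZ _ hirr hnl x hx
  obtain ⟨V, hV, hVχ⟩ := hirr
  rw [← hVχ] at hχc hχ1 hχx
  have htid : LinearMap.trace ℂ V LinearMap.id = V.character 1 := by
    simp [FDRep.char_one]
  -- the commutator acts trivially
  have hρc : V.ρ ⁅x, y⁆ = 1 := by
    obtain ⟨c, hc⟩ := vz_schur V (V.ρ ⁅x, y⁆) (fun g => by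
      change V.ρ _ * V.ρ _ = V.ρ _ * V.ρ _
      rw [← map_mul, ← map_mul, Subgroup.mem_center_iff.1 hcZ g])
    have ht := congrArg (LinearMap.trace ℂ V) hc
    rw [map_smul, htid, smul_eq_mul] at ht
    change V.character _ = _ at ht
    rw [hχc] at ht
    have : c = 1 := by
      have h' : (c - 1) * V.character 1 = 0 := by linear_combination -ht
      rcases mul_eq_zero.1 h' with h | h
      · exact sub_eq_zero.1 h
      · exact absurd h hχ1
    rw [hc, this, one_smul]
    rfl
  have hker : ⁅x, y⁆ ∈ V.ρ.ker := hρc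
  obtain ⟨c, hc⟩ := vz_schur V (V.ρ x) (fun g => by
    change V.ρ _ * V.ρ _ = V.ρ _ * V.ρ _
    have h1 : ⁅x, g⁆ ∈ V.ρ.ker :=
      (Subgroup.zpowers_le.2 hker) (vz_mem_zpowers hVZ hcyc x y hxy x g)
    have h2 : x * g = ⁅x, g⁆ * (g * x) := by rw [commutatorElement_def]; group
    rw [← map_mul, ← map_mul, h2, map_mul, MonoidHom.mem_ker.1 h1, one_mul])
  have ht := congrArg (LinearMap.trace ℂ V) hc
  rw [map_smul, htid, smul_eq_mul] at ht
  change V.character _ = _ at ht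
  rw [hχx] at ht
  have hc0 : c = 0 := by
    rcases mul_eq_zero.1 ht.symm with h | h
    · exact h
    · exact absurd h hχ1
  rw [hc0, zero_smul] at hc
  have h1 : V.ρ 1 = 0 := by
    rw [← mul_inv_cancel x, map_mul, hc, zero_mul]
  apply hχ1
  unfold FDRep.character
  rw [h1, map_zero]
end

section
/- Let G be a VZ-group. Write n, x, y, z for the numbers of Galois conjugacy classes over ℚ of irreducible complex characters (equivalently, the numbers of irreducible rational representations) of G, G/G', Z(G), and Z(G)/G' respectively. Then n = x + y − z. -/
/-- The field of character values `ℚ(χ)`. -/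
noncomputable def QChar {G : Type} (χ : G → ℂ) : Subfield ℂ :=
  Subfield.closure (Set.range χ)

/-- `χ` and `ψ` are Galois conjugate over `ℚ`. -/
def IsGaloisConjugate {G : Type} (χ ψ : G → ℂ) : Prop :=
  QChar χ = QChar ψ ∧ ∃ σ : ↥(QChar χ) ≃+* ↥(QChar χ),
    ∀ g : G, (σ ⟨χ g, Subfield.subset_closure (Set.mem_range_self g)⟩ : ℂ) = ψ g

/-- The number of Galois conjugacy classes over `ℚ` of irreducible complex characters of
`G`, i.e. the number of irreducible rational representations of `G`. -/
noncomputable def numRatIrr (G : Type) [Group G] : ℕ :=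
  Nat.card (Quot (fun χ ψ : {χ : G → ℂ // IsIrrChar G χ} => IsGaloisConjugate χ.1 ψ.1))


def IGC {H : Type} (K : Subfield ℂ) (χ ψ : H → ℂ) : Prop :=
  QChar χ = K ∧ QChar ψ = K ∧ ∃ σ : K ≃+* K, ∀ (g : H) (a : K), (a : ℂ) = χ g → ((σ a : K) : ℂ) = ψ g

lemma igc_iff {H : Type} (χ ψ : H → ℂ) : IsGaloisConjugate χ ψ ↔ ∃ K, IGC K χ ψ := by
  constructor
  · rintro ⟨h, σ, hσ⟩
    refine ⟨_, rfl, h.symm, σ, fun g a ha => ?_⟩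
    rw [← hσ g]
    congr 2
    exact Subtype.ext ha
  · rintro ⟨K, rfl, h, σ, hσ⟩
    exact ⟨h.symm, σ, fun g => hσ g _ rfl⟩

lemma igc_comp {H H' : Type} (π : H → H') (hπ : Function.Surjective π) (χ ψ : H' → ℂ) :
    IsGaloisConjugate (χ ∘ π) (ψ ∘ π) ↔ IsGaloisConjugate χ ψ := by
  have hq : ∀ χ : H' → ℂ, QChar (χ ∘ π) = QChar χ := fun χ => by
    unfold QChar; rw [hπ.range_comp]
  simp only [igc_iff, IGC, hq, hπ.forall, Function.comp]

open Classical in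
noncomputable def extZ {G : Type} [Group G] (Z : Subgroup G) (D : ℕ) (l : Z → ℂ) : G → ℂ :=
  fun g => if h : g ∈ Z then D * l ⟨g, h⟩ else 0

lemma extZ_coe {G : Type} [Group G] (Z : Subgroup G) (D : ℕ) (l : Z → ℂ) (z : Z) :
    extZ Z D l z = D * l z := by simp [extZ]

lemma extZ_not {G : Type} [Group G] (Z : Subgroup G) (D : ℕ) (l : Z → ℂ) (g : G) (h : g ∉ Z) :
    extZ Z D l g = 0 := by simp [extZ, h]

lemma QChar_ext {G : Type} [Group G] (Z : Subgroup G) (D : ℕ) (hD : D ≠ 0) (l : Z → ℂ) :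
    QChar (extZ Z D l) = QChar l := by
  have hD' : (D : ℂ) ≠ 0 := by exact_mod_cast hD
  apply le_antisymm
  · unfold QChar
    rw [Subfield.closure_le]
    rintro _ ⟨g, rfl⟩
    by_cases h : g ∈ Z
    · have := extZ_coe Z D l ⟨g, h⟩
      simp only at this
      rw [this]
      exact mul_mem (natCast_mem _ D) (Subfield.subset_closure ⟨_, rfl⟩)
    · rw [extZ_not _ _ _ _ h]; exact zero_mem _
  · unfold QChar
    rw [Subfield.closure_le]
    rintro _ ⟨z, rfl⟩
    have : l z = (D : ℂ)⁻¹ * extZ Z D l z := by rw [extZ_coe]; field_simp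
    rw [this]
    exact mul_mem (inv_mem (natCast_mem _ D)) (Subfield.subset_closure ⟨_, rfl⟩)

lemma igc_ext {G : Type} [Group G] (Z : Subgroup G) (D : ℕ) (hD : D ≠ 0) (l m : Z → ℂ) :
    IsGaloisConjugate (extZ Z D l) (extZ Z D m) ↔ IsGaloisConjugate l m := by
  have hD' : (D : ℂ) ≠ 0 := by exact_mod_cast hD
  simp only [igc_iff, IGC, QChar_ext Z D hD]
  refine exists_congr fun K => and_congr_right fun hl => and_congr_right fun hm =>
    exists_congr fun σ => ?_
  constructor
  · intro h z a ha
    have := h z (D * a) (by rw [extZ_coe]; simp [ha])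
    rw [extZ_coe] at this
    simpa [hD] using this
  · intro h g a ha
    by_cases hg : g ∈ Z
    · have e := extZ_coe Z D l ⟨g, hg⟩
      have e' := extZ_coe Z D m ⟨g, hg⟩
      simp only at e e'
      rw [e'] 
      rw [e] at ha
      have hb : l ⟨g, hg⟩ ∈ K := by rw [← hl]; exact Subfield.subset_closure ⟨_, rfl⟩
      have : a = D * ⟨_, hb⟩ := by ext; simp [ha]
      rw [this]
      simp [h _ ⟨_, hb⟩ rfl]
    · rw [extZ_not _ _ _ _ hg] at ha ⊢
      have : a = 0 := by ext; simp [ha]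
      simp [this]

lemma igc_one {H : Type} {χ ψ : H → ℂ} (h : IsGaloisConjugate χ ψ) (g : H) :
    χ g = 1 ↔ ψ g = 1 := by
  obtain ⟨_, σ, hσ⟩ := h
  rw [← hσ g]
  constructor
  · intro h1
    have : (⟨χ g, Subfield.subset_closure (Set.mem_range_self g)⟩ : QChar χ) = 1 := by ext; simp [h1]
    rw [this]; simp
  · intro h1
    have h2 : σ ⟨χ g, Subfield.subset_closure (Set.mem_range_self g)⟩ = 1 := by ext; simp [h1]
    rw [map_eq_one_iff σ σ.injective] at h2
    exact congrArg Subtype.val h2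

noncomputable def nr {H : Type} (p : (H → ℂ) → Prop) : ℕ :=
  Nat.card (Quot (fun χ ψ : {χ : H → ℂ // p χ} => IsGaloisConjugate χ.1 ψ.1))

lemma nr_congr {H H' : Type} (p : (H → ℂ) → Prop) (p' : (H' → ℂ) → Prop)
    (F : (H → ℂ) → (H' → ℂ)) (hF : Function.Injective F) (h1 : ∀ χ, p χ → p' (F χ))
    (h2 : ∀ χ', p' χ' → ∃ χ, p χ ∧ F χ = χ')
    (h3 : ∀ χ ψ, IsGaloisConjugate (F χ) (F ψ) ↔ IsGaloisConjugate χ ψ) : nr p = nr p' := by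
  let f : {χ // p χ} → {χ // p' χ} := fun χ => ⟨F χ.1, h1 _ χ.2⟩
  have hf : Function.Bijective f := by
    constructor
    · intro a b hab
      exact Subtype.ext (hF (congrArg Subtype.val hab))
    · rintro ⟨c, hc⟩
      obtain ⟨χ, hχ, rfl⟩ := h2 c hc
      exact ⟨⟨χ, hχ⟩, rfl⟩
  exact Nat.card_congr (Quot.congr (Equiv.ofBijective f hf) fun a b => (h3 a.1 b.1).symm)

lemma nr_split {H : Type} (p q : (H → ℂ) → Prop)
    (hq : ∀ χ ψ, p χ → p ψ → IsGaloisConjugate χ ψ → (q χ ↔ q ψ))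
    (hf1 : Finite {χ // p χ ∧ q χ}) (hf2 : Finite {χ // p χ ∧ ¬ q χ}) :
    nr p = nr (fun χ => p χ ∧ q χ) + nr (fun χ => p χ ∧ ¬ q χ) := by
  classical
  unfold nr
  rw [← Nat.card_sum]
  refine Nat.card_congr ⟨?_, ?_, ?_, ?_⟩
  · refine Quot.lift (fun χ => if h : q χ.1 then Sum.inl (Quot.mk _ ⟨χ.1, χ.2, h⟩)
      else Sum.inr (Quot.mk _ ⟨χ.1, χ.2, h⟩)) ?_
    intro a b hab
    by_cases h : q a.1
    · have h' := (hq _ _ a.2 b.2 hab).1 h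
      rw [dif_pos h, dif_pos h']
      exact congrArg Sum.inl (Quot.sound hab)
    · have h' : ¬ q b.1 := fun hh => h ((hq _ _ a.2 b.2 hab).2 hh)
      rw [dif_neg h, dif_neg h']
      exact congrArg Sum.inr (Quot.sound hab)
  · refine Sum.elim (Quot.lift (fun χ => Quot.mk _ ⟨χ.1, χ.2.1⟩) ?_)
      (Quot.lift (fun χ => Quot.mk _ ⟨χ.1, χ.2.1⟩) ?_)
    · intro a b hab; exact Quot.sound hab
    · intro a b hab; exact Quot.sound hab
  · intro a
    induction a using Quot.ind with | _ a =>
    by_cases h : q a.1 <;> simp [h]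
  · rintro (a | a)
    · induction a using Quot.ind with | _ a =>
      simp [a.2.2]
    · induction a using Quot.ind with | _ a =>
      simp [a.2.2]

section reps
open scoped commutatorElement
open Representation Module

lemma irr_elim {G : Type} [Group G] [Fintype G] {χ : G → ℂ} (h : IsIrrChar G χ) :
    ∃ (V : Type) (_ : AddCommGroup V) (_ : Module ℂ V) (_ : FiniteDimensional ℂ V)
      (ρ : Representation ℂ G V), χ = ρ.character ∧
        ∑ g : G, ρ.character g * ρ.character g⁻¹ = Nat.card G := by
  obtain ⟨V, hV, rfl⟩ := h
  refine ⟨V, inferInstance, inferInstance, inferInstance, V.ρ, rfl, ?_⟩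
  exact (FDRep.simple_iff_char_is_norm_one V).1 hV

lemma irr_of_norm {G : Type} [Group G] [Fintype G] {V : Type} [AddCommGroup V] [Module ℂ V]
    [FiniteDimensional ℂ V] (ρ : Representation ℂ G V)
    (h : ∑ g : G, ρ.character g * ρ.character g⁻¹ = Nat.card G) : IsIrrChar G ρ.character :=
  ⟨FDRep.of ρ, (FDRep.simple_iff_char_is_norm_one _).2 h, rfl⟩

@[reducible]
noncomputable def invCard (G : Type) [Group G] [Fintype G] : Invertible (Nat.card G : ℂ) :=
  invertibleOfNonzero (by exact_mod_cast Nat.card_pos.ne')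

lemma irr_of_irr {G : Type} [Group G] [Fintype G] {V : Type} [AddCommGroup V] [Module ℂ V]
    [FiniteDimensional ℂ V] (ρ : Representation ℂ G V) (h : IsIrreducible ρ) :
    IsIrrChar G ρ.character := by
  apply irr_of_norm
  have := invCard G
  have h1 := card_inv_mul_sum_char_mul_char_eq_finrank ρ ρ
  rw [IsIrreducible.finrank_intertwiningMap_self] at h1
  have hc : (Nat.card G : ℂ) ≠ 0 := by exact_mod_cast Nat.card_pos.ne'
  field_simp at h1
  simpa using h1

lemma schur {G : Type} [Group G] [Fintype G] {V : Type} [AddCommGroup V] [Module ℂ V]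
    [FiniteDimensional ℂ V] (ρ : Representation ℂ G V)
    (h : ∑ g : G, ρ.character g * ρ.character g⁻¹ = Nat.card G) (hV : Nontrivial V)
    (T : V →ₗ[ℂ] V) (hT : ∀ g, T ∘ₗ ρ g = ρ g ∘ₗ T) : ∃ c : ℂ, T = c • LinearMap.id := by
  have := invCard G
  have h1 := card_inv_mul_sum_char_mul_char_eq_finrank ρ ρ
  have hc : (Nat.card G : ℂ) ≠ 0 := by exact_mod_cast Nat.card_pos.ne'
  rw [h, inv_mul_cancel₀ hc] at h1
  have h2 : finrank ℂ (IntertwiningMap ρ ρ) = 1 := by exact_mod_cast h1.symm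
  let I : IntertwiningMap ρ ρ := ⟨LinearMap.id, fun g => by simp⟩
  have hI : I ≠ 0 := by
    intro h0
    obtain ⟨v, hv⟩ := exists_ne (0 : V)
    have : I v = 0 := by rw [h0]; rfl
    exact hv this
  obtain ⟨c, hc⟩ := (finrank_eq_one_iff_of_nonzero' I hI).1 h2 ⟨T, hT⟩
  refine ⟨c, ?_⟩
  have := congrArg IntertwiningMap.toLinearMap hc
  exact this.symm

lemma scal {H : Type} [Group H] {V : Type} [AddCommGroup V] [Module ℂ V]
    [FiniteDimensional ℂ V] (ρ : Representation ℂ H V) (hV : Nontrivial V)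
    (h : ∀ g, ∃ c : ℂ, ρ g = c • LinearMap.id) :
    ∃ f : H →* ℂ, ∀ g, ρ g = f g • LinearMap.id := by
  choose c hc using h
  obtain ⟨v, hv⟩ := exists_ne (0 : V)
  have key : ∀ a b : ℂ, a • v = b • v → a = b := fun a b hab => smul_left_injective ℂ hv hab
  have hv' : ∀ g, ρ g v = c g • v := fun g => by rw [hc]; simp
  refine ⟨⟨⟨c, key _ _ ?_⟩, fun a b => key _ _ ?_⟩, hc⟩
  · rw [← hv']; simp
  · rw [← hv', map_mul, Module.End.mul_apply, hv', map_smul, hv', smul_smul, mul_comm]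

lemma nontriv_of_norm {G : Type} [Group G] [Fintype G] {V : Type} [AddCommGroup V] [Module ℂ V]
    [FiniteDimensional ℂ V] (ρ : Representation ℂ G V)
    (h : ∑ g : G, ρ.character g * ρ.character g⁻¹ = Nat.card G) : Nontrivial V := by
  by_contra hV
  rw [not_nontrivial_iff_subsingleton] at hV
  have h0 : ∀ g, ρ.character g = 0 := fun g => by
    have : ρ g = 0 := Subsingleton.elim _ _
    simp [character, this]
  simp only [h0, mul_zero, Finset.sum_const_zero] at h
  have hc : (Nat.card G : ℂ) ≠ 0 := by exact_mod_cast Nat.card_pos.ne'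
  exact hc h.symm

/-- commuting images imply linear -/
lemma lin_of_comm {G : Type} [Group G] [Fintype G] {V : Type} [AddCommGroup V] [Module ℂ V]
    [FiniteDimensional ℂ V] (ρ : Representation ℂ G V)
    (h : ∑ g : G, ρ.character g * ρ.character g⁻¹ = Nat.card G)
    (hcomm : ∀ a b, ρ a ∘ₗ ρ b = ρ b ∘ₗ ρ a) : ∃ f : G →* ℂ, ρ.character = f := by
  have hV := nontriv_of_norm ρ h
  obtain ⟨f, hf⟩ := scal ρ hV (fun g => schur ρ h hV _ (hcomm g))
  have hch : ∀ g, ρ.character g = f g * finrank ℂ V := fun g => by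
    simp [character, hf]
  have hfi : ∀ g, f g * f g⁻¹ = 1 := fun g => by rw [← map_mul]; simp
  have hc : (Nat.card G : ℂ) ≠ 0 := by exact_mod_cast Nat.card_pos.ne'
  have : ∀ g, ρ.character g * ρ.character g⁻¹ = (finrank ℂ V : ℂ) ^ 2 := fun g => by
    rw [hch, hch]; linear_combination (finrank ℂ V : ℂ) ^ 2 * hfi g
  simp only [this, Finset.sum_const, Finset.card_univ, ← Nat.card_eq_fintype_card, nsmul_eq_mul] at h
  have h1 : (finrank ℂ V : ℂ) ^ 2 = 1 := by
    apply mul_left_cancel₀ hc; rw [h, mul_one]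
  have h2 : finrank ℂ V ^ 2 = 1 := by exact_mod_cast h1
  have h3 : finrank ℂ V = 1 := by simpa using h2
  refine ⟨f, funext fun g => ?_⟩
  rw [hch, h3]; simp

lemma irr_hom {G : Type} [Group G] [Fintype G] (f : G →* ℂ) : IsIrrChar G f := by
  let ρ : Representation ℂ G ℂ := (algebraMap ℂ (Module.End ℂ ℂ) : ℂ →* _).comp f
  have hch : ρ.character = f := by
    funext g
    have : ρ g = f g • LinearMap.id := by ext; simp [ρ]
    simp [character, this]
  rw [← hch]
  apply irr_of_norm
  have hfi : ∀ g, f g * f g⁻¹ = 1 := fun g => by rw [← map_mul]; simp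
  simp only [hch, hfi]
  simp

lemma irr_lin {G : Type} [Group G] [Fintype G] {χ : G → ℂ} (h : IsIrrChar G χ) (h1 : χ 1 = 1) :
    ∃ f : G →* ℂ, χ = f := by
  obtain ⟨V, _, _, _, ρ, rfl, hn⟩ := irr_elim h
  apply lin_of_comm ρ hn
  have hd : finrank ℂ V = 1 := by
    rw [char_one] at h1; exact_mod_cast h1
  obtain ⟨v, hv, hv'⟩ := finrank_eq_one_iff'.1 hd
  intro a b
  obtain ⟨ca, ha⟩ := hv' (ρ a v)
  obtain ⟨cb, hb⟩ := hv' (ρ b v)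
  ext w
  obtain ⟨c, rfl⟩ := hv' w
  simp [← ha, ← hb, smul_smul, mul_comm, mul_left_comm]

lemma irr_comm_iff {H : Type} [Group H] [Fintype H] (hc : ∀ a b : H, a * b = b * a) (χ : H → ℂ) :
    IsIrrChar H χ ↔ ∃ f : H →* ℂ, χ = f := by
  constructor
  · intro h
    obtain ⟨V, _, _, _, ρ, rfl, hn⟩ := irr_elim h
    apply lin_of_comm ρ hn
    intro a b
    have := congrArg ρ (hc a b)
    rw [map_mul, map_mul] at this
    exact this
  · rintro ⟨f, rfl⟩; exact irr_hom f

lemma trace_compl {G : Type} [Group G] {V : Type} [AddCommGroup V] [Module ℂ V]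
    [FiniteDimensional ℂ V] (ρ : Representation ℂ G V) (σ τ : Subrepresentation ρ)
    (h : IsCompl σ.toSubmodule τ.toSubmodule) (g : G) :
    ρ.character g = σ.toRepresentation.character g + τ.toRepresentation.character g := by
  let N : Bool → Submodule ℂ V := fun b => bif b then σ.toSubmodule else τ.toSubmodule
  have hN : DirectSum.IsInternal N := by
    rw [DirectSum.isInternal_submodule_iff_isCompl N (i := true) (j := false) (by simp) (by ext b; cases b <;> simp)]
    exact h
  have hm : ∀ i, Set.MapsTo (ρ g) (N i) (N i) := by
    rintro (_ | _)
    · exact τ.apply_mem_toSubmodule g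
    · exact σ.apply_mem_toSubmodule g
  have := LinearMap.trace_eq_sum_trace_restrict hN hm
  rw [Fintype.sum_bool] at this
  exact this

lemma exists_compl {G : Type} [Group G] [Fintype G] {V : Type} [AddCommGroup V] [Module ℂ V]
    (ρ : Representation ℂ G V) (σ : Subrepresentation ρ) :
    ∃ τ : Subrepresentation ρ, IsCompl σ.toSubmodule τ.toSubmodule := by
  have : NeZero (Nat.card G : ℂ) := ⟨by exact_mod_cast Nat.card_pos.ne'⟩
  have hs : IsSemisimpleRepresentation ρ := inferInstance
  obtain ⟨τ, hτ⟩ := hs.exists_isCompl σ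
  refine ⟨τ, ?_⟩
  rw [isCompl_iff, disjoint_iff, codisjoint_iff] at hτ ⊢
  exact ⟨congrArg Subrepresentation.toSubmodule hτ.1, congrArg Subrepresentation.toSubmodule hτ.2⟩

lemma rep_cases {G : Type} [Group G] {V : Type} [AddCommGroup V] [Module ℂ V]
    (ρ : Representation ℂ G V) (hV : Nontrivial V) :
    IsIrreducible ρ ∨ ∃ σ : Subrepresentation ρ, σ.toSubmodule ≠ ⊥ ∧ σ.toSubmodule ≠ ⊤ := by
  by_contra! h
  obtain ⟨h1, h2⟩ := h
  apply h1
  have : Nontrivial (Subrepresentation ρ) := ⟨⊥, ⊤, fun h => by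
    have := congrArg Subrepresentation.toSubmodule h
    exact (bot_ne_top (α := Submodule ℂ V)) this⟩
  refine ⟨fun σ => ?_⟩
  by_cases hσ : σ.toSubmodule = ⊥
  · left; exact Subrepresentation.toSubmodule_injective hσ
  · right; exact Subrepresentation.toSubmodule_injective (h2 σ hσ)

lemma char_nat {G : Type} [Group G] [Fintype G] (g : G)
    (hg : ∀ χ, IsIrrChar G χ → ∃ n : ℕ, χ g = n) (d : ℕ) :
    ∀ (V : Type) [AddCommGroup V] [Module ℂ V] [FiniteDimensional ℂ V]
    (ρ : Representation ℂ G V), finrank ℂ V = d → ∃ n : ℕ, ρ.character g = n := by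
  induction d using Nat.strong_induction_on with
  | _ d ih =>
  intro V _ _ _ ρ hd
  rcases subsingleton_or_nontrivial V with hV | hV
  · refine ⟨0, ?_⟩
    have : ρ g = 0 := Subsingleton.elim _ _
    simp [character, this]
  rcases rep_cases ρ hV with h | ⟨σ, h1, h2⟩
  · exact hg _ (irr_of_irr ρ h)
  obtain ⟨τ, hτ⟩ := exists_compl ρ σ
  have hadd := Submodule.finrank_add_eq_of_isCompl hτ
  have hlt := Submodule.finrank_lt h2
  have hpos : 0 < finrank ℂ σ.toSubmodule :=
    Nat.pos_of_ne_zero fun h => h1 (Submodule.finrank_eq_zero.1 h)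
  obtain ⟨a, ha⟩ := ih _ (by omega) σ.toSubmodule σ.toRepresentation rfl
  obtain ⟨b, hb⟩ := ih (finrank ℂ τ.toSubmodule) (by omega) τ.toSubmodule τ.toRepresentation rfl
  exact ⟨a + b, by rw [trace_compl ρ σ τ hτ, ha, hb]; simp⟩

lemma exists_over {G : Type} [Group G] [Fintype G] (l : Subgroup.center G → ℂ) (d : ℕ) :
    ∀ (V : Type) [AddCommGroup V] [Module ℂ V] [FiniteDimensional ℂ V]
    (ρ : Representation ℂ G V), Nontrivial V → (∀ z : Subgroup.center G, ρ (z : G) = l z • LinearMap.id) →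
      finrank ℂ V = d → ∃ χ, IsIrrChar G χ ∧ ∀ z : Subgroup.center G, χ z = χ 1 * l z := by
  induction d using Nat.strong_induction_on with
  | _ d ih =>
  intro V _ _ _ ρ hV hl hd
  rcases rep_cases ρ hV with h | ⟨σ, h1, h2⟩
  · refine ⟨_, irr_of_irr ρ h, fun z => ?_⟩
    rw [char_one]
    simp [character, hl, mul_comm]
  have hlt := Submodule.finrank_lt h2
  refine ih _ (by omega) σ.toSubmodule σ.toRepresentation
    ((Submodule.nontrivial_iff_ne_bot).2 h1) (fun z => ?_) rfl
  ext v
  have := congrArg (fun T => T (v : V)) (hl z)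
  exact this

/-- right regular representation on functions -/
def regR (G : Type) [Group G] : Representation ℂ G (G → ℂ) where
  toFun g := LinearMap.funLeft ℂ ℂ (fun x => x * g)
  map_one' := by ext; simp [LinearMap.funLeft]
  map_mul' a b := by ext; simp [LinearMap.funLeft, mul_assoc]

lemma regR_apply {G : Type} [Group G] (g : G) (f : G → ℂ) (x : G) : regR G g f x = f (x * g) := rfl

lemma regR_char {G : Type} [Group G] [Fintype G] (g : G) (hg : g ≠ 1) : (regR G).character g = 0 := by
  classical
  rw [character, LinearMap.trace_eq_matrix_trace ℂ (Pi.basisFun ℂ G), Matrix.trace]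
  apply Finset.sum_eq_zero
  intro x _
  simp [LinearMap.toMatrix_apply, regR_apply, Pi.single_apply, hg]

lemma exists_ne_nat {G : Type} [Group G] [Fintype G] (g : G) (hg : g ≠ 1)
    (h : ∀ χ, IsIrrChar G χ → ∃ n : ℕ, χ g = n) : False := by
  let σ : Subrepresentation (regR G) :=
    ⟨Submodule.span ℂ {fun _ => (1 : ℂ)}, by
      intro g v hv
      obtain ⟨c, rfl⟩ := Submodule.mem_span_singleton.1 hv
      rw [Submodule.mem_span_singleton]
      exact ⟨c, by ext x; simp [regR_apply]⟩⟩
  obtain ⟨τ, hτ⟩ := exists_compl _ σ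
  have h1 : σ.toRepresentation.character g = 1 := by
    have : σ.toRepresentation g = LinearMap.id := by
      apply LinearMap.ext
      rintro ⟨v, hv⟩
      apply Subtype.ext
      obtain ⟨c, rfl⟩ := Submodule.mem_span_singleton.1 hv
      ext x
      rfl
    rw [character, this, LinearMap.trace_id]
    have : finrank ℂ σ.toSubmodule = 1 := finrank_span_singleton (fun h => by
      have := congrFun h 1; simp at this)
    rw [this]; simp
  obtain ⟨n, hn⟩ := char_nat g h _ τ.toSubmodule τ.toRepresentation rfl
  have := trace_compl _ σ τ hτ g
  rw [regR_char g hg, h1, hn] at this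
  have h2 : ((1 + n : ℕ) : ℂ) = 0 := by push_cast; exact this.symm
  have h3 : 1 + n = 0 := by exact_mod_cast h2
  omega

lemma hom_comm {G : Type} [Group G] (f : G →* ℂ) (g : G) (hg : g ∈ commutator G) : f g = 1 := by
  have h := Abelianization.commutator_subset_ker (f.toHomUnits) hg
  rw [MonoidHom.mem_ker] at h
  have := congrArg Units.val h
  simpa using this

lemma comm_le {G : Type} [Group G] [Fintype G] (hVZ : IsVZ G) :
    commutator G ≤ Subgroup.center G := by
  intro g hg
  by_contra hz
  refine exists_ne_nat g (fun h => hz (h ▸ one_mem _)) fun χ hχ => ?_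
  by_cases h1 : χ 1 = 1
  · obtain ⟨f, rfl⟩ := irr_lin hχ h1
    exact ⟨1, by simpa using hom_comm f g hg⟩
  · exact ⟨0, by simpa using hVZ χ hχ h1 g hz⟩

noncomputable def DD (G : Type) [Group G] : ℕ := Nat.sqrt (Nat.card G / Nat.card (Subgroup.center G))

lemma nonlin {G : Type} [Group G] [Fintype G] (hVZ : IsVZ G) {χ : G → ℂ} (h : IsIrrChar G χ)
    (h1 : χ 1 ≠ 1) : DD G ≠ 0 ∧ ∃ l : Subgroup.center G →* ℂ,
      (∃ z : Subgroup.center G, (z : G) ∈ commutator G ∧ l z ≠ 1) ∧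
      χ = extZ (Subgroup.center G) (DD G) l := by
  have hv := hVZ χ h h1
  obtain ⟨V, _, _, _, ρ, rfl, hn⟩ := irr_elim h
  have hV := nontriv_of_norm ρ hn
  obtain ⟨l, hl⟩ := scal (ρ.comp (Subgroup.center G).subtype) hV (fun z => by
    refine schur ρ hn hV _ fun g => ?_
    have := congrArg ρ (Subgroup.mem_center_iff.1 z.2 g)
    rw [map_mul, map_mul] at this
    exact this.symm)
  have hl' : ∀ z : Subgroup.center G, ρ (z : G) = l z • LinearMap.id := hl
  have hch : ∀ z : Subgroup.center G, ρ.character z = finrank ℂ V * l z := fun z => by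
    simp [character, hl', mul_comm]
  have hli : ∀ g, l g * l g⁻¹ = 1 := fun g => by rw [← map_mul]; simp
  have hd : finrank ℂ V ^ 2 * Nat.card (Subgroup.center G) = Nat.card G := by
    classical
    have e : ∑ g : G, ρ.character g * ρ.character g⁻¹ =
        ∑ z : Subgroup.center G, ρ.character z * ρ.character (z : G)⁻¹ := by
      symm
      rw [← Finset.sum_subtype (Finset.univ.filter (· ∈ Subgroup.center G)) (by simp)
        (fun g => ρ.character g * ρ.character g⁻¹)]
      apply Finset.sum_subset (Finset.subset_univ _)
      intro x _ hx
      rw [hv x (by simpa using hx), zero_mul]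
    have e2 : ∀ z : Subgroup.center G, ρ.character z * ρ.character (z : G)⁻¹ = (finrank ℂ V : ℂ) ^ 2 := by
      intro z
      have := hch z⁻¹
      rw [Subgroup.coe_inv] at this
      rw [this, hch]
      linear_combination (finrank ℂ V : ℂ) ^ 2 * hli z
    rw [e] at hn
    simp only [e2, Finset.sum_const, Finset.card_univ, ← Nat.card_eq_fintype_card, nsmul_eq_mul] at hn
    rw [mul_comm]
    exact_mod_cast hn
  have hD : DD G = finrank ℂ V := by
    rw [DD, ← hd, Nat.mul_div_cancel _ Nat.card_pos, pow_two, Nat.sqrt_eq]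
  refine ⟨by rw [hD]; exact finrank_pos.ne', l, ?_, ?_⟩
  · by_contra! hc
    apply h1
    have hG := comm_le hVZ
    obtain ⟨f, hf⟩ := lin_of_comm ρ hn (fun a b => by
      have hm : ⁅a, b⁆ ∈ commutator G := Subgroup.commutator_mem_commutator (Subgroup.mem_top a) (Subgroup.mem_top b)
      have := hl' ⟨_, hG hm⟩
      rw [hc ⟨_, hG hm⟩ hm, one_smul] at this
      have e : a * b = ⁅a, b⁆ * (b * a) := by simp [commutatorElement_def, mul_assoc]
      have := congrArg (fun T => T * (ρ (b * a))) this
      beta_reduce at this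
      rw [← map_mul, ← e, map_mul, map_mul] at this
      exact this)
    rw [hf]; simp
  · funext g
    by_cases hg : g ∈ Subgroup.center G
    · have := extZ_coe (Subgroup.center G) (DD G) l ⟨g, hg⟩
      simp only at this
      rw [this, hD, ← hch]
    · rw [hv g hg, extZ_not _ _ _ _ hg]

lemma exists_irr_over {G : Type} [Group G] [Fintype G] (l : Subgroup.center G →* ℂ) :
    ∃ χ, IsIrrChar G χ ∧ ∀ z : Subgroup.center G, χ z = χ 1 * l z := by
  let σ : Subrepresentation (regR G) :=
    ⟨{ carrier := {f | ∀ (z : Subgroup.center G) (x : G), f (z * x) = l z * f x}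
       add_mem' := fun {a b} ha hb z x => by simp [ha z x, hb z x, mul_add]
       zero_mem' := fun z x => by simp
       smul_mem' := fun c a ha z x => by simp [ha z x, mul_left_comm] }, by
      intro g v hv z x
      rw [regR_apply, regR_apply, mul_assoc]
      exact hv z _⟩
  have hmem : extZ (Subgroup.center G) 1 l ∈ σ.toSubmodule := by
    intro z x
    by_cases hx : x ∈ Subgroup.center G
    · have e1 := extZ_coe (Subgroup.center G) 1 l (z * ⟨x, hx⟩)
      have e2 := extZ_coe (Subgroup.center G) 1 l ⟨x, hx⟩
      simp only [Subgroup.coe_mul] at e1 e2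
      rw [e1, e2, map_mul]; ring
    · rw [extZ_not _ _ _ _ hx, extZ_not, mul_zero]
      exact fun h => hx ((Subgroup.mul_mem_cancel_left _ z.2).1 h)
  have hne : extZ (Subgroup.center G) 1 l ≠ 0 := by
    intro h
    have := congrFun h ((1 : Subgroup.center G) : G)
    rw [extZ_coe] at this
    simp at this
  refine exists_over l _ σ.toSubmodule σ.toRepresentation ?_ ?_ rfl
  · rw [Submodule.nontrivial_iff_ne_bot, Submodule.ne_bot_iff]
    exact ⟨_, hmem, hne⟩
  · intro z
    apply LinearMap.ext
    rintro ⟨f, hf⟩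
    apply Subtype.ext
    funext x
    change f (x * z) = l z * f x
    rw [Subgroup.mem_center_iff.1 z.2 x]
    exact hf z x

lemma ext_irr {G : Type} [Group G] [Fintype G] (hVZ : IsVZ G) (l : Subgroup.center G →* ℂ)
    (hl : ∃ z : Subgroup.center G, (z : G) ∈ commutator G ∧ l z ≠ 1) :
    DD G ≠ 0 ∧ IsIrrChar G (extZ (Subgroup.center G) (DD G) l) ∧
      extZ (Subgroup.center G) (DD G) l 1 ≠ 1 := by
  obtain ⟨χ, hχ, hz⟩ := exists_irr_over l
  have h1 : χ 1 ≠ 1 := by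
    intro h1
    obtain ⟨f, rfl⟩ := irr_lin hχ h1
    obtain ⟨z, hzc, hlz⟩ := hl
    apply hlz
    have := hz z
    rw [hom_comm f z hzc, h1, one_mul] at this
    exact this.symm
  obtain ⟨hD, m, -, rfl⟩ := nonlin hVZ hχ h1
  have hD' : (DD G : ℂ) ≠ 0 := by exact_mod_cast hD
  have : (m : Subgroup.center G → ℂ) = l := by
    funext z
    have e := hz z
    have e1 := extZ_coe (Subgroup.center G) (DD G) m 1
    rw [extZ_coe] at e
    rw [Subgroup.coe_one] at e1
    rw [e1, map_one, mul_one] at e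
    exact mul_left_cancel₀ hD' e
  rw [this] at hχ h1
  exact ⟨hD, hχ, h1⟩

lemma fin_hom (H : Type) [Group H] [Fintype H] : Finite {χ : H → ℂ // ∃ f : H →* ℂ, χ = f} := by
  have : Finite (H →* ℂˣ) := inferInstance
  refine Finite.of_surjective (α := H →* ℂˣ)
    (fun f => ⟨fun h => (f h : ℂ), (Units.coeHom ℂ).comp f, rfl⟩) ?_
  rintro ⟨_, f, rfl⟩
  exact ⟨f.toHomUnits, Subtype.ext (funext fun h => by simp)⟩

lemma nr_quot {H : Type} [Group H] [Fintype H] (N : Subgroup H) [N.Normal]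
    (hc : ∀ a b : H ⧸ N, a * b = b * a) :
    numRatIrr (H ⧸ N) = nr (fun χ : H → ℂ => (∃ f : H →* ℂ, χ = f) ∧ ∀ n ∈ N, χ n = 1) := by
  have : Fintype (H ⧸ N) := Fintype.ofFinite _
  change nr (IsIrrChar (H ⧸ N)) = _
  have hs : Function.Surjective (QuotientGroup.mk' N) := QuotientGroup.mk'_surjective N
  apply nr_congr _ _ (fun χ => χ ∘ QuotientGroup.mk' N)
  · exact hs.injective_comp_right
  · intro χ hχ
    obtain ⟨f, rfl⟩ := (irr_comm_iff hc χ).1 hχ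
    refine ⟨⟨f.comp (QuotientGroup.mk' N), rfl⟩, fun n hn => ?_⟩
    have : QuotientGroup.mk' N n = 1 := by simpa using hn
    simp only [Function.comp]
    rw [this, map_one]
  · rintro _ ⟨⟨f, rfl⟩, hf⟩
    refine ⟨QuotientGroup.lift N f (fun n hn => hf n hn), ?_, ?_⟩
    · exact irr_hom _
    · funext x; rfl
  · intro χ ψ
    exact igc_comp _ hs χ ψ

end reps

/-- For a VZ-group `G`, with `n, x, y, z` the numbers of irreducible rational
representations of `G`, `G/G'`, `Z(G)`, `Z(G)/G'` respectively, we have `n = x + y - z`. -/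
theorem stmt15 {G : Type} [Group G] [Fintype G] (hVZ : IsVZ G) :
    numRatIrr G =
      numRatIrr (G ⧸ commutator G) + numRatIrr ↥(Subgroup.center G) -
        numRatIrr (↥(Subgroup.center G) ⧸ (commutator G).subgroupOf (Subgroup.center G)) := by
  have : Fintype (Subgroup.center G) := Fintype.ofFinite _
  have hcz : ∀ a b : Subgroup.center G, a * b = b * a := fun a b =>
    Subtype.ext (Subgroup.mem_center_iff.1 b.2 a)
  have hG := comm_le hVZ
  rw [nr_quot (commutator G) (fun a b => mul_comm (G := Abelianization G) a b),
    nr_quot ((commutator G).subgroupOf (Subgroup.center G)) (fun a b => by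
      induction a using QuotientGroup.induction_on with | _ a =>
      induction b using QuotientGroup.induction_on with | _ b =>
      rw [← QuotientGroup.mk_mul, ← QuotientGroup.mk_mul, hcz])]
  have hfz : Finite {χ : Subgroup.center G → ℂ // IsIrrChar _ χ} := by
    simp only [irr_comm_iff hcz]
    exact fin_hom _
  have hfg := fin_hom G
  let q : (Subgroup.center G → ℂ) → Prop := fun l =>
    ∀ n ∈ (commutator G).subgroupOf (Subgroup.center G), l n = 1
  have hfz2 : Finite {l : Subgroup.center G → ℂ // IsIrrChar _ l ∧ ¬ q l} :=
    Finite.of_injective (fun χ => (⟨χ.1, χ.2.1⟩ : {χ : Subgroup.center G → ℂ // IsIrrChar _ χ}))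
      (fun a b h => Subtype.ext (Subtype.mk.inj h))
  have hz : numRatIrr (Subgroup.center G) = nr (fun l => IsIrrChar (Subgroup.center G) l ∧ q l) +
      nr (fun l => IsIrrChar (Subgroup.center G) l ∧ ¬ q l) := by
    apply nr_split
    · intro χ ψ _ _ h
      exact forall₂_congr fun n _ => igc_one h n
    · exact Finite.of_injective (fun χ => (⟨χ.1, χ.2.1⟩ : {χ : Subgroup.center G → ℂ // IsIrrChar _ χ}))
        (fun a b h => Subtype.ext (Subtype.mk.inj h))
    · exact Finite.of_injective (fun χ => (⟨χ.1, χ.2.1⟩ : {χ : Subgroup.center G → ℂ // IsIrrChar _ χ}))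
        (fun a b h => Subtype.ext (Subtype.mk.inj h))
  have hq : ∀ l : Subgroup.center G → ℂ, ¬ q l ↔
      ∃ z : Subgroup.center G, (z : G) ∈ commutator G ∧ l z ≠ 1 := by
    intro l
    simp only [q, Subgroup.mem_subgroupOf]
    push Not
    rfl
  have hn : numRatIrr G = nr (fun χ => IsIrrChar G χ ∧ χ 1 = 1) +
      nr (fun χ => IsIrrChar G χ ∧ ¬ χ 1 = 1) := by
    apply nr_split
    · intro χ ψ _ _ h
      exact igc_one h 1
    · exact Finite.of_injective (fun χ => (⟨χ.1, irr_lin χ.2.1 χ.2.2⟩ :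
        {χ : G → ℂ // ∃ f : G →* ℂ, χ = f})) (fun a b h => Subtype.ext (Subtype.mk.inj h))
    · refine Finite.of_surjective (α := {l : Subgroup.center G → ℂ // IsIrrChar _ l ∧ ¬ q l})
        (fun l => ⟨extZ (Subgroup.center G) (DD G) l.1, ?_⟩) ?_
      · obtain ⟨l, h1, h2⟩ := l
        obtain ⟨f, rfl⟩ := (irr_comm_iff hcz l).1 h1
        exact (ext_irr hVZ f ((hq _).1 h2)).2
      · rintro ⟨χ, h1, h2⟩
        obtain ⟨_, l, hl, rfl⟩ := nonlin hVZ h1 h2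
        exact ⟨⟨l, irr_hom l, (hq _).2 hl⟩, rfl⟩
  have e1 : nr (fun χ : G → ℂ => IsIrrChar G χ ∧ χ 1 = 1) =
      nr (fun χ : G → ℂ => (∃ f : G →* ℂ, χ = f) ∧ ∀ n ∈ commutator G, χ n = 1) := by
    congr 1
    funext χ
    refine propext ⟨?_, ?_⟩
    · rintro ⟨h1, h2⟩
      obtain ⟨f, rfl⟩ := irr_lin h1 h2
      exact ⟨⟨f, rfl⟩, hom_comm f⟩
    · rintro ⟨⟨f, rfl⟩, _⟩
      exact ⟨irr_hom f, map_one f⟩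
  have e2 : nr (fun l : Subgroup.center G → ℂ => (∃ f : Subgroup.center G →* ℂ, l = f) ∧
      ∀ n ∈ (commutator G).subgroupOf (Subgroup.center G), l n = 1) =
      nr (fun l => IsIrrChar (Subgroup.center G) l ∧ q l) := by
    congr 1
    funext l
    rw [irr_comm_iff hcz]
  have e3 : nr (fun l => IsIrrChar (Subgroup.center G) l ∧ ¬ q l) =
      nr (fun χ => IsIrrChar G χ ∧ ¬ χ 1 = 1) := by
    by_cases hD : DD G = 0
    · have i1 : IsEmpty {l : Subgroup.center G → ℂ // IsIrrChar _ l ∧ ¬ q l} := ⟨by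
        rintro ⟨l, h1, h2⟩
        obtain ⟨f, rfl⟩ := (irr_comm_iff hcz l).1 h1
        exact (ext_irr hVZ f ((hq _).1 h2)).1 hD⟩
      have i2 : IsEmpty {χ : G → ℂ // IsIrrChar G χ ∧ ¬ χ 1 = 1} := ⟨by
        rintro ⟨χ, h1, h2⟩
        exact (nonlin hVZ h1 h2).1 hD⟩
      unfold nr
      rw [Nat.card_of_isEmpty, Nat.card_of_isEmpty]
    · have hD' : (DD G : ℂ) ≠ 0 := by exact_mod_cast hD
      apply nr_congr _ _ (extZ (Subgroup.center G) (DD G))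
      · intro l m h
        funext z
        have := congrFun h z
        rw [extZ_coe, extZ_coe] at this
        exact mul_left_cancel₀ hD' this
      · rintro l ⟨h1, h2⟩
        obtain ⟨f, rfl⟩ := (irr_comm_iff hcz l).1 h1
        exact (ext_irr hVZ f ((hq _).1 h2)).2
      · rintro χ ⟨h1, h2⟩
        obtain ⟨_, l, hl, rfl⟩ := nonlin hVZ h1 h2
        exact ⟨l, ⟨irr_hom l, (hq _).2 hl⟩, rfl⟩
      · exact igc_ext _ _ hD
  rw [hn, hz, e1, e2, e3]
  omega
end

section
/- Let G be a VZ p-group with cyclic center. Then all non-linear irreducible complex characters of G are faithful and pairwise Galois conjugate over ℚ; in particular G has exactly one Galois conjugacy class of non-linear irreducible characters, i.e., exactly one irreducible rational representation whose kernel does not contain G'. -/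
open CategoryTheory in
lemma schur_aux {G : Type} [Group G] (V : FDRep ℂ G) (hV : Simple V)
    (T : V →ₗ[ℂ] V) (hT : ∀ g, T ∘ₗ V.ρ g = V.ρ g ∘ₗ T) : ∃ c : ℂ, T = c • LinearMap.id := by
  have h1 : Module.finrank ℂ (V ⟶ V) = 1 := finrank_endomorphism_simple_eq_one ℂ V
  let f : V ⟶ V := ⟨InducedCategory.homMk (ModuleCat.ofHom T), fun g ↦ by
    ext x
    exact congrArg (fun q => q x) (hT g)⟩
  obtain ⟨c, hc⟩ := (finrank_eq_one_iff_of_nonzero' (𝟙 V) (id_nonzero V)).mp h1 f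
  refine ⟨c, ?_⟩
  have := congrArg (fun q : V ⟶ V => q.hom.hom.hom) hc
  exact this.symm

open CategoryTheory in
lemma simple_of_irr {G : Type} [Group G] [Fintype G] {V : Type} [AddCommGroup V] [Module ℂ V]
    [FiniteDimensional ℂ V] (ρ : Representation ℂ G V) [ρ.IsIrreducible] :
    Simple (FDRep.of ρ) := by
  rw [FDRep.simple_iff_char_is_norm_one]
  have h0 : (Nat.card G : ℂ) ≠ 0 := by simp
  have := invertibleOfNonzero h0
  have h := ρ.card_inv_mul_sum_char_mul_char_eq_finrank ρ
  rw [Representation.IsIrreducible.finrank_intertwiningMap_self] at h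
  have h2 : ∑ g : G, ρ.character g * ρ.character g⁻¹ = Nat.card G := by
    field_simp at h
    simpa using h
  exact h2

open CategoryTheory in
lemma kill_aux0 {G : Type} [Group G] [Fintype G] (r : MonoidAlgebra ℂ G)
    (h : ∀ V : FDRep ℂ G, Simple V → Representation.asAlgebraHom V.ρ r = 0)
    (M : Type) [AddCommGroup M] [Module (MonoidAlgebra ℂ G) M]
    [IsSimpleModule (MonoidAlgebra ℂ G) M] (m : M) : r • m = 0 := by
  let _ : Module ℂ M := Module.compHom M (algebraMap ℂ (MonoidAlgebra ℂ G))
  have : IsScalarTower ℂ (MonoidAlgebra ℂ G) M := ⟨fun c x m => by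
    rw [Algebra.smul_def, mul_smul]; rfl⟩
  let ρ : Representation ℂ G M := Representation.ofModule' M
  have hρ : ∀ s : MonoidAlgebra ℂ G, ∀ m : M, Representation.asAlgebraHom ρ s m = s • m := by
    intro s m
    have : Representation.asAlgebraHom ρ = Algebra.lsmul ℂ ℂ M :=
      (MonoidAlgebra.lift ℂ (Module.End ℂ M) G).apply_symm_apply _
    rw [this]
    rfl
  let e : ρ.asModule ≃ₗ[MonoidAlgebra ℂ G] M :=
    { ρ.asModuleEquiv.toAddEquiv with
      map_smul' := fun s m => by
        exact (Representation.asModuleEquiv_map_smul ρ s m).trans (hρ s _) }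
  have hirr : ρ.IsIrreducible := by
    rw [Representation.irreducible_iff_isSimpleModule_asModule]
    exact IsSimpleModule.congr e
  have : FiniteDimensional ℂ M := Module.Finite.trans (MonoidAlgebra ℂ G) M
  have h2 := h (FDRep.of ρ) (simple_of_irr _)
  rw [FDRep.of_ρ'] at h2
  have h3 := congrArg (fun T => T m) h2
  exact (hρ r m).symm.trans h3

open CategoryTheory in
lemma kill_aux {G : Type} [Group G] [Fintype G] (r : MonoidAlgebra ℂ G)
    (h : ∀ V : FDRep ℂ G, Simple V → Representation.asAlgebraHom V.ρ r = 0) : r = 0 := by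
  have hJ := IsSemisimpleRing.jacobson_eq_bot (MonoidAlgebra ℂ G)
  suffices hr : r ∈ Ring.jacobson (MonoidAlgebra ℂ G) by
    rw [hJ] at hr; simpa using hr
  rw [Ring.jacobson, Module.jacobson, Submodule.mem_sInf]
  intro I hI
  have hs : IsSimpleModule (MonoidAlgebra ℂ G) (MonoidAlgebra ℂ G ⧸ I) := by
    rwa [isSimpleModule_iff_isCoatom]
  have h4 := kill_aux0 r h (MonoidAlgebra ℂ G ⧸ I) (Submodule.Quotient.mk 1)
  rw [← Submodule.Quotient.mk_smul, Submodule.Quotient.mk_eq_zero] at h4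
  simpa using h4

lemma irr_dim_pos {G : Type} [Group G] (V : FDRep ℂ G) (hV : CategoryTheory.Simple V) :
    Module.finrank ℂ V ≠ 0 := by
  intro h0
  have hs : Subsingleton V := Module.finrank_zero_iff.1 h0
  apply CategoryTheory.id_nonzero V
  ext x
  exact Subsingleton.elim (α := V) _ _

/-- conjugacy classes of noncentral elements absorb the commutator subgroup -/
lemma conj_aux {G : Type} [Group G] [Fintype G] (hVZ : IsVZ G) (x : G)
    (hx : x ∉ Subgroup.center G) (u v : G) : IsConj x (x * (u * v * u⁻¹ * v⁻¹)) := by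
  classical
  let a : MonoidAlgebra ℂ G := ∑ g : G, MonoidAlgebra.of ℂ G (g * x * g⁻¹)
  have key : a * (MonoidAlgebra.of ℂ G (u * v * u⁻¹ * v⁻¹) - 1) = 0 := by
    apply kill_aux
    intro V hV
    rw [map_mul, map_sub, map_one, Representation.asAlgebraHom_of]
    by_cases h1 : V.character 1 = 1
    · have hd : Module.finrank ℂ V = 1 := by
        rw [FDRep.char_one] at h1
        exact_mod_cast h1
      have hsc : ∀ g : G, ∃ c : ℂ, V.ρ g = c • LinearMap.id := fun g => by
        obtain ⟨c, hc, -⟩ := LinearMap.existsUnique_eq_smul_id_of_finrank_eq_one hd (V.ρ g)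
        exact ⟨c, hc⟩
      have hcomm : V.ρ (u * v * u⁻¹ * v⁻¹) = 1 := by
        have h2 : V.ρ u * V.ρ v = V.ρ v * V.ρ u := by
          obtain ⟨c, hc⟩ := hsc u
          rw [hc]
          ext y
          simp
        rw [map_mul, map_mul, map_mul, h2, ← map_mul, ← map_mul, ← map_mul]
        simp
      rw [hcomm, sub_self, mul_zero]
    · have ha : Representation.asAlgebraHom V.ρ a = ∑ g : G, V.ρ (g * x * g⁻¹) := by
        simp only [a, map_sum, Representation.asAlgebraHom_of]
      obtain ⟨c, hc⟩ := schur_aux V hV (∑ g : G, V.ρ (g * x * g⁻¹)) (fun h => by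
        change (∑ g : G, V.ρ (g * x * g⁻¹)) * V.ρ h = V.ρ h * (∑ g : G, V.ρ (g * x * g⁻¹))
        rw [Finset.sum_mul, Finset.mul_sum]
        refine Fintype.sum_equiv (Equiv.mulLeft h⁻¹) _ _ (fun g => ?_)
        rw [← map_mul, ← map_mul]
        congr 1
        simp only [Equiv.coe_mulLeft]
        group)
      have ht := congrArg (LinearMap.trace ℂ V) hc
      rw [map_sum, map_smul, LinearMap.trace_id] at ht
      have hz : ∀ g : G, LinearMap.trace ℂ V (V.ρ (g * x * g⁻¹)) = 0 := fun g => by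
        have := hVZ V.character ⟨V, hV, rfl⟩ h1 x hx
        rw [← FDRep.char_conj V x g] at this
        exact this
      simp only [hz, Finset.sum_const_zero] at ht
      have hd := irr_dim_pos V hV
      have hc0 : c = 0 := by
        have h3 : (Module.finrank ℂ V : ℂ) ≠ 0 := by exact_mod_cast hd
        rcases mul_eq_zero.1 (smul_eq_mul c _ ▸ ht.symm) with h | h
        · exact h
        · exact absurd h h3
      rw [ha, hc, hc0, zero_smul, zero_mul]
  rw [mul_sub, mul_one, sub_eq_zero] at key
  have hcoef := congrArg (fun f : MonoidAlgebra ℂ G => f.coeff (x * (u * v * u⁻¹ * v⁻¹))) key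
  by_contra hn
  have hzero : a.coeff (x * (u * v * u⁻¹ * v⁻¹)) = 0 := by
    simp only [a, MonoidAlgebra.of_apply, MonoidAlgebra.coeff_sum, Finsupp.finsetSum_apply]
    refine Finset.sum_eq_zero (fun g _ => ?_)
    rw [MonoidAlgebra.coeff_single, Finsupp.single_apply, if_neg]
    intro h
    exact hn (isConj_iff.2 ⟨g, h⟩)
  have hpos : a.coeff x ≠ 0 := by
    simp only [a, MonoidAlgebra.of_apply, MonoidAlgebra.coeff_sum, Finsupp.finsetSum_apply,
      MonoidAlgebra.coeff_single, Finsupp.single_apply]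
    rw [Finset.sum_boole]
    norm_cast
    rw [← ne_eq, Finset.card_ne_zero]
    exact ⟨1, by simp⟩
  simp only [hzero, MonoidAlgebra.of_apply] at hcoef
  rw [MonoidAlgebra.coeff_mul_single_apply] at hcoef
  rw [mul_inv_cancel_right, mul_one] at hcoef
  exact hpos hcoef

lemma group_aux {p k : ℕ} {G : Type} [Group G] [Fintype G]
    (hcard : Fintype.card G = p ^ k)
    (h : ∀ x : G, x ∉ Subgroup.center G → ∀ u v : G, IsConj x (x * (u * v * u⁻¹ * v⁻¹)))
    (u v : G) : (u * v * u⁻¹ * v⁻¹) ∈ Subgroup.center G ∧ (u * v * u⁻¹ * v⁻¹) ^ p = 1 := by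
  classical
  have h1 : (u * v * u⁻¹ * v⁻¹) ∈ Subgroup.center G := by
    by_contra hn
    have := h _ hn v u
    rw [show u * v * u⁻¹ * v⁻¹ * (v * u * v⁻¹ * u⁻¹) = 1 by group] at this
    rw [isConj_one_left] at this
    rw [this] at hn
    exact hn (one_mem _)
  refine ⟨h1, ?_⟩
  by_cases hu : u ∈ Subgroup.center G
  · rw [Subgroup.mem_center_iff] at hu
    rw [← hu v]
    simp
  have hex : ∃ n, u ^ p ^ n ∈ Subgroup.center G :=
    ⟨k, by rw [← hcard, pow_card_eq_one]; exact one_mem _⟩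
  have hm := Nat.find_spec hex
  have hlt : ∀ m < Nat.find hex, u ^ p ^ m ∉ Subgroup.center G := fun m hm => Nat.find_min hex hm
  obtain ⟨m, hm'⟩ : ∃ m, Nat.find hex = m + 1 := by
    refine Nat.exists_eq_succ_of_ne_zero ?_
    intro h0
    rw [h0] at hm
    simp at hm
    exact hu hm
  have hx := hlt m (by omega)
  rw [hm', pow_succ, pow_mul] at hm
  generalize u ^ p ^ m = x at hx hm
  obtain ⟨g, hg⟩ := isConj_iff.1 (h x hx u v)
  generalize u * v * u⁻¹ * v⁻¹ = c at *
  have e1 : (x * c) ^ p = x ^ p * c ^ p :=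
    Commute.mul_pow (Subgroup.mem_center_iff.1 h1 x) p
  rw [← hg, conj_pow, Subgroup.mem_center_iff.1 hm g, mul_inv_cancel_right] at e1
  simpa using e1.symm

lemma struct_aux {p k : ℕ} (hp : p.Prime) {G : Type} [Group G] [Fintype G]
    (hcard : Fintype.card G = p ^ k) (hVZ : IsVZ G)
    (hcyc : IsCyclic ↥(Subgroup.center G)) (χ : G → ℂ) (hχ : IsIrrChar G χ) (h1 : χ 1 ≠ 1) :
    ∃ (d : ℕ) (μ : ↥(Subgroup.center G) →* ℂ), d ≠ 0 ∧
      d ^ 2 * Nat.card ↥(Subgroup.center G) = Nat.card G ∧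
      Function.Injective μ ∧ (∀ z : ↥(Subgroup.center G), χ z = d * μ z) ∧
      (∀ g, g ∉ Subgroup.center G → χ g = 0) := by
  classical
  have hoff := hVZ χ hχ h1
  obtain ⟨V, hV, rfl⟩ := hχ
  have hd := irr_dim_pos V hV
  have hdC : (Module.finrank ℂ V : ℂ) ≠ 0 := by exact_mod_cast hd
  have hnt : Nontrivial V := Module.nontrivial_of_finrank_pos (Nat.pos_of_ne_zero hd)
  have hsc : ∀ z : ↥(Subgroup.center G), ∃ c : ℂ, V.ρ z = c • LinearMap.id := fun z => by
    apply schur_aux V hV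
    intro g
    change V.ρ z * V.ρ g = V.ρ g * V.ρ z
    rw [← map_mul, ← map_mul, Subgroup.mem_center_iff.1 z.2 g]
  choose f hf using hsc
  have hinj : ∀ a b : ℂ, a • (LinearMap.id : V →ₗ[ℂ] V) = b • LinearMap.id → a = b := by
    intro a b hab
    have := congrArg (LinearMap.trace ℂ V) hab
    rw [map_smul, map_smul, LinearMap.trace_id, smul_eq_mul, smul_eq_mul] at this
    exact mul_right_cancel₀ hdC this
  let μ : ↥(Subgroup.center G) →* ℂ :=
    { toFun := f
      map_one' := hinj _ _ (by rw [← hf]; simp; rfl)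
      map_mul' := fun x y => hinj _ _ (by
        rw [← hf, Subgroup.coe_mul, map_mul, hf, hf]
        ext y
        simp [mul_smul, smul_comm (f _) (f _) y]) }
  have hμ : ∀ z : ↥(Subgroup.center G), V.ρ z = μ z • LinearMap.id := hf
  have hχz : ∀ z : ↥(Subgroup.center G), V.character z = Module.finrank ℂ V * μ z := by
    intro z
    rw [FDRep.character, hμ, map_smul, LinearMap.trace_id, smul_eq_mul, mul_comm]
  have hsum : (Module.finrank ℂ V) ^ 2 * Nat.card ↥(Subgroup.center G) = Nat.card G := by
    have h2 := (FDRep.simple_iff_char_is_norm_one V).1 hV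
    have h3 : ∀ g : G, V.character g * V.character g⁻¹ =
        if g ∈ Subgroup.center G then (Module.finrank ℂ V : ℂ) ^ 2 else 0 := by
      intro g
      split_ifs with hg
      · have e1 := hχz ⟨g, hg⟩
        have e2 := hχz ⟨g, hg⟩⁻¹
        have e3 : μ ⟨g, hg⟩ * μ ⟨g, hg⟩⁻¹ = 1 := by rw [← map_mul, mul_inv_cancel, map_one]
        simp only [InvMemClass.coe_inv] at e1 e2
        rw [e1, e2]
        linear_combination (Module.finrank ℂ V : ℂ) ^ 2 * e3
      · rw [hoff g hg, zero_mul]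
    simp only [h3] at h2
    rw [← Finset.sum_filter, Finset.sum_const, nsmul_eq_mul, mul_comm] at h2
    have h4 : (Finset.univ.filter (fun g : G => g ∈ Subgroup.center G)).card
        = Nat.card ↥(Subgroup.center G) := by
      rw [Nat.card_eq_fintype_card, Fintype.card_subtype]
    rw [h4] at h2
    exact_mod_cast h2
  refine ⟨Module.finrank ℂ V, μ, hd, hsum, ?_, hχz, hoff⟩
  -- injectivity
  rw [injective_iff_map_eq_one]
  intro z hz
  by_contra hne
  have hG := group_aux hcard (conj_aux hVZ)
  have hcomm1 : ∀ u v : G, V.ρ (u * v * u⁻¹ * v⁻¹) = 1 := by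
    intro u v
    obtain ⟨hc, hcp⟩ := hG u v
    obtain ⟨j, hj, hj2⟩ : ∃ j, j ≤ k ∧ orderOf z = p ^ j := by
      rw [← Nat.dvd_prime_pow hp, ← hcard, ← Subgroup.orderOf_coe]
      exact orderOf_dvd_card
    have hj0 : j ≠ 0 := by
      rintro rfl
      rw [pow_zero, orderOf_eq_one_iff] at hj2
      exact hne hj2
    obtain ⟨i, rfl⟩ := Nat.exists_eq_succ_of_ne_zero hj0
    have hw : orderOf (z ^ p ^ i) = p := by
      rw [orderOf_pow' _ (pow_ne_zero _ hp.ne_zero), hj2, pow_succ, Nat.gcd_mul_right_left]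
      exact Nat.mul_div_cancel_left _ (pow_pos hp.pos _)
    have hsub := IsCyclic.card_pow_eq_one_le (α := ↥(Subgroup.center G)) hp.pos
    have hmem : (⟨_, hc⟩ : ↥(Subgroup.center G)) ∈ Subgroup.zpowers (z ^ p ^ i) := by
      have heq : (Finset.univ.filter (fun y : ↥(Subgroup.center G) =>
          y ∈ Subgroup.zpowers (z ^ p ^ i))) =
          (Finset.univ.filter (fun y : ↥(Subgroup.center G) => y ^ p = 1)) := by
        apply Finset.eq_of_subset_of_card_le
        · intro y hy
          simp only [Finset.mem_filter, Finset.mem_univ, true_and] at hy ⊢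
          rw [← orderOf_dvd_iff_pow_eq_one, ← hw]
          exact orderOf_dvd_of_mem_zpowers hy
        · refine hsub.trans ?_
          rw [← Fintype.card_subtype, ← Nat.card_eq_fintype_card]
          change p ≤ Nat.card (Subgroup.zpowers (z ^ p ^ i))
          rw [Nat.card_zpowers, hw]
      have : (⟨_, hc⟩ : ↥(Subgroup.center G)) ∈
          (Finset.univ.filter (fun y : ↥(Subgroup.center G) => y ^ p = 1)) := by
        simp only [Finset.mem_filter, Finset.mem_univ, true_and]
        exact Subtype.ext hcp
      rw [← heq] at this
      simpa using this
    rw [← mem_powers_iff_mem_zpowers] at hmem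
    obtain ⟨n, hn⟩ := hmem
    have h5 : μ ⟨_, hc⟩ = 1 := by
      rw [← hn]
      simp only [map_pow, hz, one_pow]
    have h6 := hμ ⟨_, hc⟩
    rw [h5, one_smul] at h6
    exact h6
  have hcomm : ∀ u v : G, V.ρ u * V.ρ v = V.ρ v * V.ρ u := by
    intro u v
    have := congrArg (· * (V.ρ (v * u))) (hcomm1 u v)
    simp only [← map_mul, one_mul] at this
    rw [← map_mul, ← map_mul, ← this]
    congr 1
    group
  have hall : ∀ g : G, g ∈ Subgroup.center G := by
    intro g
    by_contra hg
    obtain ⟨c, hc⟩ := schur_aux V hV (V.ρ g) (fun h => hcomm g h)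
    have h7 := hoff g hg
    rw [FDRep.character, hc, map_smul, LinearMap.trace_id, smul_eq_mul] at h7
    have hc0 := (mul_eq_zero.1 h7).resolve_right hdC
    have h8 : V.ρ g * V.ρ g⁻¹ = 1 := by rw [← map_mul, mul_inv_cancel, map_one]
    rw [hc, hc0, zero_smul, zero_mul] at h8
    exact zero_ne_one h8
  have htop : Subgroup.center G = ⊤ := by
    rw [eq_top_iff]; intro g _; exact hall g
  rw [htop, Subgroup.card_top] at hsum
  have h9 : (Module.finrank ℂ V) ^ 2 = 1 := by
    have : 0 < Nat.card G := Nat.card_pos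
    exact Nat.eq_of_mul_eq_mul_right this (by rw [hsum, one_mul])
  have h10 : Module.finrank ℂ V = 1 := by
    simpa using h9
  apply h1
  rw [FDRep.char_one, h10, Nat.cast_one]

open IntermediateField in
lemma galois_le {G : Type} [Group G] [Fintype G] (hcyc : IsCyclic ↥(Subgroup.center G))
    (d : ℕ) (χ ψ : G → ℂ) (μ ν : ↥(Subgroup.center G) →* ℂ)
    (hμ : Function.Injective μ) (hν : Function.Injective ν)
    (h1 : ∀ z : ↥(Subgroup.center G), χ z = d * μ z)
    (h2 : ∀ g, g ∉ Subgroup.center G → χ g = 0)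
    (h3 : ∀ z : ↥(Subgroup.center G), ψ z = d * ν z)
    (h4 : ∀ g, g ∉ Subgroup.center G → ψ g = 0) :
    QChar ψ ≤ QChar χ ∧ ∃ φ : ↥(QChar χ) →+* ℂ,
      ∀ g, φ ⟨χ g, Subfield.subset_closure (Set.mem_range_self g)⟩ = ψ g := by
  obtain ⟨γ, hγ⟩ := hcyc.exists_generator
  have hpos : 0 < orderOf γ := orderOf_pos γ
  have hζ : IsPrimitiveRoot (μ γ) (orderOf γ) := by
    rw [← orderOf_injective μ hμ γ]; exact IsPrimitiveRoot.orderOf _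
  have hζ' : IsPrimitiveRoot (ν γ) (orderOf γ) := by
    rw [← orderOf_injective ν hν γ]; exact IsPrimitiveRoot.orderOf _
  have hgen : ∀ z : ↥(Subgroup.center G), ∃ n : ℕ, γ ^ n = z := fun z => by
    have := hγ z
    rw [← mem_powers_iff_mem_zpowers] at this
    exact this
  have : NeZero (orderOf γ) := ⟨hpos.ne'⟩
  constructor
  · obtain ⟨i, -, hi⟩ := hζ.eq_pow_of_pow_eq_one hζ'.pow_eq_one
    rw [QChar, Subfield.closure_le]
    rintro _ ⟨g, rfl⟩
    by_cases hg : g ∈ Subgroup.center G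
    · obtain ⟨n, hn⟩ := hgen ⟨g, hg⟩
      have e : ψ g = χ ((⟨g, hg⟩ : ↥(Subgroup.center G)) ^ i : ↥(Subgroup.center G)) := by
        rw [h1, h3 ⟨g, hg⟩, ← hn, map_pow, map_pow, map_pow, ← hi, pow_right_comm]
      rw [e]
      exact Subfield.subset_closure (Set.mem_range_self _)
    · rw [h4 g hg]; exact zero_mem _
  · have hint : IsIntegral ℚ (μ γ) := (hζ.isIntegral hpos).tower_top
    have hmin : minpoly ℚ (μ γ) = minpoly ℚ (ν γ) := by
      rw [← Polynomial.cyclotomic_eq_minpoly_rat hζ hpos,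
        ← Polynomial.cyclotomic_eq_minpoly_rat hζ' hpos]
    let Φ : ℚ⟮μ γ⟯ →ₐ[ℚ] ℂ := (IntermediateField.adjoin.powerBasis hint).lift (ν γ) (by
      rw [IntermediateField.adjoin.powerBasis_gen, IntermediateField.minpoly_gen, hmin]
      exact minpoly.aeval _ _)
    have hΦ : Φ (IntermediateField.AdjoinSimple.gen ℚ (μ γ)) = ν γ := by
      have := (IntermediateField.adjoin.powerBasis hint).lift_gen (ν γ) (by
        rw [IntermediateField.adjoin.powerBasis_gen, IntermediateField.minpoly_gen, hmin]
        exact minpoly.aeval _ _)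
      have hg := IntermediateField.adjoin.powerBasis_gen hint
      rw [← hg]
      exact this
    have hkey : ∀ g, ∃ y : ℚ⟮μ γ⟯, (y : ℂ) = χ g ∧ Φ y = ψ g := by
      intro g
      by_cases hg : g ∈ Subgroup.center G
      · obtain ⟨n, hn⟩ := hgen ⟨g, hg⟩
        refine ⟨(d : ℚ⟮μ γ⟯) * IntermediateField.AdjoinSimple.gen ℚ (μ γ) ^ n, ?_, ?_⟩
        · rw [h1 ⟨g, hg⟩, ← hn]
          simp
        · rw [h3 ⟨g, hg⟩, ← hn, map_mul, map_pow, hΦ, map_pow, map_natCast]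
      · exact ⟨0, by simp [h2 g hg], by simp [h4 g hg]⟩
    have hle : QChar χ ≤ (ℚ⟮μ γ⟯).toSubfield := by
      rw [QChar, Subfield.closure_le]
      rintro _ ⟨g, rfl⟩
      obtain ⟨y, hy, -⟩ := hkey g
      rw [← hy]
      exact y.2
    refine ⟨Φ.toRingHom.comp (Subfield.inclusion hle), fun g => ?_⟩
    obtain ⟨y, hy, hy2⟩ := hkey g
    rw [← hy2]
    change Φ _ = Φ _
    congr 1
    exact Subtype.ext hy.symm

/-- In a VZ `p`-group with cyclic center, every non-linear irreducible complex character
is faithful, and any two non-linear irreducible characters are Galois conjugate over `ℚ`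
(so there is exactly one irreducible rational representation whose kernel does not
contain `G'`). -/
theorem stmt16 {p k : ℕ} (hp : p.Prime) {G : Type} [Group G] [Fintype G]
    (hcard : Fintype.card G = p ^ k) (hVZ : IsVZ G)
    (hcyc : IsCyclic ↥(Subgroup.center G)) :
    (∀ χ : G → ℂ, IsIrrChar G χ → χ 1 ≠ 1 → {g : G | χ g = χ 1} = {1}) ∧
      (∀ χ ψ : G → ℂ, IsIrrChar G χ → IsIrrChar G ψ → χ 1 ≠ 1 → ψ 1 ≠ 1 →
        IsGaloisConjugate χ ψ) := by
  refine ⟨?_, ?_⟩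
  · intro χ hχ h1
    obtain ⟨d, μ, hd, -, hμ, hz, hoff⟩ := struct_aux hp hcard hVZ hcyc χ hχ h1
    have hdC : (d : ℂ) ≠ 0 := by exact_mod_cast hd
    have e1 : χ 1 = d := by
      have := hz 1
      rwa [map_one, mul_one] at this
    ext g
    simp only [Set.mem_ofPred_eq, Set.mem_singleton_iff]
    constructor
    · intro hg
      by_cases hgz : g ∈ Subgroup.center G
      · rw [e1, hz ⟨g, hgz⟩] at hg
        have h2 : μ ⟨g, hgz⟩ = μ 1 := by
          rw [map_one]
          exact mul_left_cancel₀ hdC (by rw [hg, mul_one])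
        exact congrArg Subtype.val (hμ h2)
      · rw [hoff g hgz, e1] at hg
        exact absurd hg.symm hdC
    · rintro rfl; rfl
  · intro χ ψ hχ hψ h1 h2
    obtain ⟨d, μ, hd, hs, hμ, hz, hoff⟩ := struct_aux hp hcard hVZ hcyc χ hχ h1
    obtain ⟨d', ν, hd', hs', hν, hz', hoff'⟩ := struct_aux hp hcard hVZ hcyc ψ hψ h2
    have hdd : d = d' := by
      have h3 : d ^ 2 = d' ^ 2 :=
        Nat.eq_of_mul_eq_mul_right (Nat.card_pos (α := ↥(Subgroup.center G))) (hs.trans hs'.symm)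
      exact Nat.pow_left_injective two_ne_zero h3
    subst hdd
    obtain ⟨hle, φ, hφ⟩ := galois_le hcyc d χ ψ μ ν hμ hν hz hoff hz' hoff'
    obtain ⟨hle', -⟩ := galois_le hcyc d ψ χ ν μ hν hμ hz' hoff' hz hoff
    have heq : QChar χ = QChar ψ := le_antisymm hle' hle
    refine ⟨heq, ?_⟩
    have hrange : φ.fieldRange = QChar ψ := by
      have htop : (Subfield.closure (Set.range (fun g : G =>
          (⟨χ g, Subfield.subset_closure (Set.mem_range_self g)⟩ : ↥(QChar χ))))) = ⊤ := by
        rw [eq_top_iff]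
        have h5 : QChar χ ≤ (Subfield.closure (Set.range (fun g : G =>
          (⟨χ g, Subfield.subset_closure (Set.mem_range_self g)⟩ : ↥(QChar χ))))).map
            (QChar χ).subtype := by
          rw [RingHom.map_field_closure]
          refine Subfield.closure_mono ?_
          rintro _ ⟨g, rfl⟩
          exact ⟨_, ⟨g, rfl⟩, rfl⟩
        rintro ⟨y, hy⟩ -
        obtain ⟨w, hw, hw2⟩ := h5 hy
        have : w = ⟨y, hy⟩ := Subtype.ext hw2
        rw [← this]
        exact hw
      rw [RingHom.fieldRange_eq_map, ← htop, RingHom.map_field_closure]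
      change Subfield.closure _ = Subfield.closure _
      congr 1
      ext y
      constructor
      · rintro ⟨_, ⟨g, rfl⟩, rfl⟩
        exact ⟨g, (hφ g).symm⟩
      · rintro ⟨g, rfl⟩
        exact ⟨_, ⟨g, rfl⟩, hφ g⟩
    have hmem : ∀ y, φ y ∈ QChar χ := fun y => by
      have h6 : φ y ∈ φ.fieldRange := ⟨y, rfl⟩
      rw [hrange] at h6
      exact hle h6
    let τ : ↥(QChar χ) →+* ↥(QChar χ) := φ.codRestrict (QChar χ) hmem
    have hτ : Function.Bijective τ := by
      refine ⟨τ.injective, fun y => ?_⟩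
      have : (y : ℂ) ∈ φ.fieldRange := by
        rw [hrange, ← heq]; exact y.2
      obtain ⟨w, hw⟩ := this
      exact ⟨w, Subtype.ext hw⟩
    exact ⟨RingEquiv.ofBijective τ hτ, fun g => hφ g⟩
end

section
/- Let G be a non-abelian p-group of order p^4 of nilpotency class 3 and H its unique abelian subgroup of index p. If ψ ∈ Irr(H) with G' ⊄ ker(ψ), then the induced character ψ^G is a non-linear irreducible character of G. Conversely, every non-linear irreducible character χ of G equals ψ^G for some ψ ∈ Irr(H) with G' ⊄ ker(ψ); moreover each non-linear χ arises from exactly p such characters ψ (the G-conjugates of any one of them), so |nl(G)| = |Irr(H | G')|/p = p² − 1. -/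
set_option linter.unusedSectionVars false

open CategoryTheory

section aux17
variable {G : Type} [Group G] [Fintype G] (H : Subgroup G)

/-- coinduced space -/
def coV (ψ : ↥H →* ℂ) : Submodule ℂ (G → ℂ) where
  carrier := {f | ∀ (h : ↥H) (x : G), f (h * x) = ψ h * f x}
  add_mem' := by
    intro a b ha hb h x
    simp only [Pi.add_apply, ha h x, hb h x]; ring
  zero_mem' := by intro h x; simp
  smul_mem' := by
    intro c a ha h x
    simp only [Pi.smul_apply, ha h x, smul_eq_mul]; ring

/-- right translation -/
def rtr : Representation ℂ G (G → ℂ) where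
  toFun g := LinearMap.funLeft ℂ ℂ (fun x => x * g)
  map_one' := by ext; simp [LinearMap.funLeft]
  map_mul' a b := by
    apply LinearMap.ext; intro f; funext x
    simp [LinearMap.funLeft_apply, mul_assoc]

theorem rtr_apply (g : G) (f : G → ℂ) (x : G) : rtr g f x = f (x * g) := rfl

/-- coinduced rep -/
def coR (ψ : ↥H →* ℂ) : Representation ℂ G (coV H ψ) where
  toFun g := (rtr g).restrict (p := coV H ψ) (q := coV H ψ) (by
    intro f hf h x
    simp only [rtr_apply, mul_assoc]
    exact hf h _)
  map_one' := by
    ext f; simp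
  map_mul' a b := by
    apply LinearMap.ext; intro f; apply Subtype.ext
    change rtr (a * b) f.1 = rtr a (rtr b f.1)
    rw [map_mul]; rfl

open Classical in
/-- averaged translation -/
noncomputable def avT (ψ : ↥H →* ℂ) (g : G) : (G → ℂ) →ₗ[ℂ] (G → ℂ) :=
  (Nat.card ↥H : ℂ)⁻¹ • ∑ h : ↥H, LinearMap.pi (fun x => ψ h⁻¹ • LinearMap.proj (h * x * g))

open Classical in
theorem avT_apply (ψ : ↥H →* ℂ) (g : G) (f : G → ℂ) (x : G) :
    avT H ψ g f x = (Nat.card ↥H : ℂ)⁻¹ * ∑ h : ↥H, ψ h⁻¹ * f (h * x * g) := by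
  simp [avT, LinearMap.sum_apply, Finset.sum_apply]

theorem avT_mem (ψ : ↥H →* ℂ) (g : G) (f : G → ℂ) : avT H ψ g f ∈ coV H ψ := by
  classical
  intro k x
  rw [avT_apply, avT_apply, mul_left_comm]
  congr 1
  rw [Finset.mul_sum]
  refine Fintype.sum_equiv (Equiv.mulRight k) (fun h : ↥H => ψ h⁻¹ * f (h * (k * x) * g))
    (fun h : ↥H => ψ k * (ψ h⁻¹ * f (h * x * g))) ?_
  intro h
  simp only [Equiv.coe_mulRight, mul_inv_rev, map_mul, Subgroup.coe_mul, mul_assoc]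
  rw [← mul_assoc (ψ k), ← map_mul]; simp

theorem avT_eq (ψ : ↥H →* ℂ) (g : G) (f : G → ℂ) (hf : f ∈ coV H ψ) : avT H ψ g f = rtr g f := by
  classical
  funext x
  rw [avT_apply, rtr_apply]
  have : ∀ h : ↥H, ψ h⁻¹ * f (h * x * g) = f (x * g) := by
    intro h
    rw [mul_assoc, hf h, ← mul_assoc, ← map_mul]; simp
  rw [Finset.sum_congr rfl fun h _ => this h]; simp

theorem coR_char (ψ : ↥H →* ℂ) (g : G) :
    LinearMap.trace ℂ _ (coR H ψ g) = inducedChar H ψ g := by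
  classical
  have h1 : coR H ψ g = (avT H ψ g).restrict (p := coV H ψ) (q := coV H ψ)
      (fun f _ => avT_mem H ψ g f) := by
    apply LinearMap.ext; intro f; apply Subtype.ext
    exact (avT_eq H ψ g f f.2).symm
  rw [h1, LinearMap.trace_restrict_eq_of_forall_mem _ _ (avT_mem H ψ g),
    LinearMap.trace_eq_matrix_trace ℂ (Pi.basisFun ℂ G), Matrix.trace, inducedChar, Finset.mul_sum]
  refine Finset.sum_congr rfl fun x _ => ?_
  simp only [Matrix.diag_apply, LinearMap.toMatrix_apply, Pi.basisFun_apply, Pi.basisFun_repr]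
  rw [avT_apply]
  congr 1
  split_ifs with hx
  · rw [Finset.sum_eq_single (⟨x * g * x⁻¹, hx⟩⁻¹ : ↥H)]
    · simp [mul_assoc]
    · intro b _ hb
      rw [Pi.single_eq_of_ne, mul_zero]
      intro h; apply hb; apply Subtype.ext
      have := eq_mul_inv_of_mul_eq (eq_mul_inv_of_mul_eq h)
      simp [this, mul_assoc]
    · simp
  · apply Finset.sum_eq_zero
    intro b _
    rw [Pi.single_eq_of_ne, mul_zero]
    intro h; apply hx
    have : x * g * x⁻¹ = (b : G)⁻¹ := by
      rw [eq_mul_inv_of_mul_eq (eq_mul_inv_of_mul_eq h)]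
      simp [mul_assoc]
    rw [this]; exact H.inv_mem b.2

/-- The induced representation as an object. -/
noncomputable def indR (ψ : ↥H →* ℂ) : FDRep ℂ G := FDRep.of (coR H ψ)

theorem indR_char (ψ : ↥H →* ℂ) : (indR H ψ).character = inducedChar H ψ := by
  funext g
  exact coR_char H ψ g

theorem exists_hom_indR (ψ : ↥H →* ℂ) (W : FDRep ℂ G) (l : W →ₗ[ℂ] ℂ)
    (hl : ∀ (h : ↥H) w, l (W.ρ h w) = ψ h * l w) (w0 : W) (hw0 : l w0 ≠ 0) :
    ∃ f : W ⟶ indR H ψ, f ≠ 0 := by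
  let L : W →ₗ[ℂ] coV H ψ := LinearMap.codRestrict (coV H ψ)
    (LinearMap.pi (fun x => l ∘ₗ W.ρ x)) (by
      intro w h x
      simp [hl])
  refine ⟨⟨InducedCategory.homMk (ModuleCat.ofHom L), ?_⟩, ?_⟩
  · intro g
    ext w
    apply Subtype.ext
    funext x
    change l (W.ρ x (W.ρ g w)) = l (W.ρ (x * g) w)
    simp
  · intro h
    apply hw0
    have h2 : L = 0 := by
      have := congrArg (fun f : W ⟶ indR H ψ => f.hom.hom.hom) h
      exact this
    have h3 : (L w0 : G → ℂ) 1 = l w0 := by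
      change l (W.ρ 1 w0) = _
      simp
    rw [← h3, h2]; rfl
end aux17

section aux17b
variable {G : Type} [Group G] [Fintype G] (H : Subgroup G)

/-- conjugate character -/
def cj [H.Normal] (ψ : ↥H →* ℂ) (x : G) : ↥H →* ℂ := ψ.comp (MulAut.conjNormal x).toMonoidHom

theorem cj_apply [H.Normal] (ψ : ↥H →* ℂ) (x : G) (h : ↥H) :
    cj H ψ x h = ψ (MulAut.conjNormal x h) := rfl

theorem cj_mul [H.Normal] (ψ : ↥H →* ℂ) (x y : G) : cj H ψ (x * y) = cj H (cj H ψ x) y := by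
  ext h; simp [cj_apply]

theorem cj_one [H.Normal] (ψ : ↥H →* ℂ) : cj H ψ 1 = ψ := by
  ext h; simp [cj_apply]

theorem ind_of_mem [H.Normal] (ψ : ↥H →* ℂ) (h : ↥H) :
    inducedChar H ψ h = (Nat.card ↥H : ℂ)⁻¹ * ∑ x : G, cj H ψ x h := by
  unfold inducedChar
  congr 1
  refine Finset.sum_congr rfl fun x _ => ?_
  have : x * (h : G) * x⁻¹ ∈ H := Subgroup.Normal.conj_mem inferInstance _ h.2 x
  rw [dif_pos this, cj_apply]
  congr 1

theorem ind_of_not_mem [H.Normal] (ψ : ↥H →* ℂ) (g : G) (hg : g ∉ H) :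
    inducedChar H ψ g = 0 := by
  unfold inducedChar
  rw [Finset.sum_eq_zero, mul_zero]
  intro x _
  rw [dif_neg]
  intro h
  apply hg
  have := Subgroup.Normal.conj_mem (H := H) inferInstance _ h x⁻¹
  simpa [mul_assoc] using this

theorem ind_cj [H.Normal] (ψ : ↥H →* ℂ) (y : G) :
    inducedChar H (cj H ψ y) = inducedChar H ψ := by
  funext g
  by_cases hg : g ∈ H
  · lift g to ↥H using hg
    rw [ind_of_mem, ind_of_mem]
    congr 1
    refine Fintype.sum_equiv (Equiv.mulLeft y) _ _ ?_
    intro x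
    simp [cj_mul]
  · rw [ind_of_not_mem _ _ _ hg, ind_of_not_mem _ _ _ hg]

theorem ind_one (ψ : ↥H →* ℂ) : inducedChar H ψ 1 = H.index := by
  unfold inducedChar
  have : ∀ x : G, x * 1 * x⁻¹ = 1 := by simp
  have h2 : (Nat.card ↥H : ℂ) * H.index = Fintype.card G := by
    rw [← Nat.card_eq_fintype_card]; exact_mod_cast H.card_mul_index
  have h3 : (Nat.card ↥H : ℂ) ≠ 0 := by exact_mod_cast Nat.card_pos.ne'
  rw [inv_mul_eq_iff_eq_mul₀ h3, h2, Finset.sum_eq_card_nsmul (b := 1)]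
  · simp
  · intro x _
    have h4 : x * 1 * x⁻¹ ∈ H := by simp
    rw [dif_pos h4]
    have : (⟨x * 1 * x⁻¹, h4⟩ : ↥H) = 1 := by ext; simp
    rw [this, map_one]

open Classical in
theorem orth {A : Type} [Group A] [Fintype A] (ψ φ : A →* ℂ) :
    ∑ a : A, ψ a * φ a⁻¹ = if ψ = φ then (Nat.card A : ℂ) else 0 := by
  let φ' : A →* ℂ :=
    { toFun := fun a => φ a⁻¹
      map_one' := by simp
      map_mul' := by intro a b; rw [mul_inv_rev, map_mul, mul_comm] }
  have h1 : ∀ a, φ a⁻¹ * φ a = 1 := by intro a; rw [← map_mul]; simp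
  have := sum_hom_units (ψ * φ')
  change ∑ a : A, ψ a * φ a⁻¹ = _ at this
  rw [this, Nat.card_eq_fintype_card]
  have h2 : ψ * φ' = 1 ↔ ψ = φ := by
    constructor
    · intro h
      ext a
      have h2 : ψ a * φ a⁻¹ = 1 := DFunLike.congr_fun h a
      calc ψ a = ψ a * (φ a⁻¹ * φ a) := by rw [h1, mul_one]
        _ = φ a := by rw [← mul_assoc, h2, one_mul]
    · rintro rfl
      ext a
      change ψ a * ψ a⁻¹ = 1
      rw [mul_comm, h1]
  simp only [h2]
  split_ifs <;> simp

open Classical in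
theorem ind_inner [H.Normal] [IsMulCommutative ↥H] (ψ φ : ↥H →* ℂ) :
    ∑ g : G, inducedChar H ψ g * inducedChar H φ g⁻¹ =
      (Nat.card ↥H : ℂ)⁻¹ * ∑ x : G, ∑ y : G, if cj H ψ x = cj H φ y then 1 else 0 := by
  have h3 : (Nat.card ↥H : ℂ) ≠ 0 := by exact_mod_cast Nat.card_pos.ne'
  have h0 : ∑ g : G, inducedChar H ψ g * inducedChar H φ g⁻¹ =
      ∑ h : ↥H, inducedChar H ψ h * inducedChar H φ ((h⁻¹ : ↥H) : G) := by
    symm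
    apply Finset.sum_of_injOn (fun h : ↥H => (h : G))
    · exact Subtype.val_injective.injOn
    · simp
    · intro g _ hg
      rw [ind_of_not_mem, zero_mul]
      intro hgH
      exact hg ⟨⟨g, hgH⟩, by simp, rfl⟩
    · intro h _; simp
  rw [h0]
  simp only [ind_of_mem]
  have h1 : ∀ h : ↥H, ((Nat.card ↥H : ℂ)⁻¹ * ∑ x : G, cj H ψ x h) *
      ((Nat.card ↥H : ℂ)⁻¹ * ∑ x : G, cj H φ x h⁻¹) =
      ((Nat.card ↥H : ℂ)⁻¹ * (Nat.card ↥H : ℂ)⁻¹) *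
        ∑ x : G, ∑ y : G, cj H ψ x h * cj H φ y h⁻¹ := by
    intro h
    rw [← Finset.sum_mul_sum]; ring
  rw [Finset.sum_congr rfl fun h _ => h1 h, ← Finset.mul_sum, Finset.sum_comm, mul_assoc]
  congr 1
  rw [inv_mul_eq_iff_eq_mul₀ h3, Finset.mul_sum]
  refine Finset.sum_congr rfl fun x _ => ?_
  rw [Finset.sum_comm, Finset.mul_sum]
  refine Finset.sum_congr rfl fun y _ => ?_
  rw [orth]
  simp

theorem ind_simple [H.Normal] [IsMulCommutative ↥H] (ψ : ↥H →* ℂ)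
    (hst : ∀ x, cj H ψ x = ψ → x ∈ H) : Simple (indR H ψ) := by
  classical
  rw [FDRep.simple_iff_char_is_norm_one, indR_char, ind_inner]
  have h3 : (Nat.card ↥H : ℂ) ≠ 0 := by exact_mod_cast Nat.card_pos.ne'
  rw [inv_mul_eq_iff_eq_mul₀ h3]
  have key : ∀ x y : G, cj H ψ x = cj H ψ y ↔ y * x⁻¹ ∈ H := by
    intro x y
    have hcomm : ∀ h : ↥H, cj H ψ h = ψ := by
      intro h
      ext k
      rw [cj_apply]
      congr 1
      ext
      rw [MulAut.conjNormal_apply]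
      have : h * k = k * h := mul_comm' h k
      have := congrArg Subtype.val this
      simp only [Subgroup.coe_mul] at this
      rw [this]; simp
    constructor
    · intro h
      apply hst
      rw [cj_mul, ← h, ← cj_mul]; simp [cj_one]
    · intro h
      have : y = y * x⁻¹ * x := by simp
      rw [this, cj_mul, hcomm ⟨_, h⟩]
  have h1 : ∀ x : G, (∑ y : G, if cj H ψ x = cj H ψ y then (1 : ℂ) else 0) = Nat.card ↥H := by
    intro x
    simp only [key]
    rw [Fintype.sum_equiv (Equiv.mulRight x⁻¹) _ (fun y => if y ∈ H then (1 : ℂ) else 0)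
      (fun y => by by_cases hy : y * x⁻¹ ∈ H <;> simp [hy])]
    rw [Finset.sum_boole]
    congr 1
    rw [Nat.card_eq_fintype_card, Fintype.card_subtype]
  rw [Finset.sum_congr rfl fun x _ => h1 x]
  simp [mul_comm]

theorem ind_eq_conj [H.Normal] [IsMulCommutative ↥H] (ψ φ : ↥H →* ℂ)
    (hst : ∀ x, cj H ψ x = ψ → x ∈ H) (h : inducedChar H φ = inducedChar H ψ) :
    ∃ x, φ = cj H ψ x := by
  classical
  by_contra! hne
  have hs := ind_simple H ψ hst
  rw [FDRep.simple_iff_char_is_norm_one, indR_char] at hs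
  nth_rewrite 1 [← h] at hs
  rw [ind_inner, Finset.sum_eq_zero, mul_zero] at hs
  · have : (Nat.card G : ℂ) ≠ 0 := by exact_mod_cast Nat.card_pos.ne'
    exact this hs.symm
  · intro x _
    apply Finset.sum_eq_zero
    intro y _
    rw [if_neg]
    intro hxy
    apply hne (y * x⁻¹)
    rw [cj_mul, ← hxy, ← cj_mul]; simp [cj_one]

/-- conjugation action -/
@[reducible]
def cjAct [H.Normal] : MulAction G (↥H →* ℂ) where
  smul x ψ := cj H ψ x⁻¹
  one_smul ψ := by
    change cj H ψ 1⁻¹ = ψ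
    rw [inv_one, cj_one]
  mul_smul x y ψ := by
    change cj H ψ (x * y)⁻¹ = cj H (cj H ψ y⁻¹) x⁻¹
    rw [mul_inv_rev, cj_mul]

theorem cj_mem [H.Normal] [IsMulCommutative ↥H] (ψ : ↥H →* ℂ) (h : G) (hh : h ∈ H) :
    cj H ψ h = ψ := by
  ext k
  rw [cj_apply]
  congr 1
  ext
  rw [MulAut.conjNormal_apply]
  have : (⟨h, hh⟩ : ↥H) * k = k * ⟨h, hh⟩ := mul_comm' _ k
  have := congrArg Subtype.val this
  simp only [Subgroup.coe_mul] at this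
  rw [this]; simp

theorem fibre_card [H.Normal] [IsMulCommutative ↥H] (ψ : ↥H →* ℂ)
    (hst : ∀ x, cj H ψ x = ψ → x ∈ H) :
    Nat.card {φ : ↥H →* ℂ // inducedChar H φ = inducedChar H ψ} = H.index := by
  let _ := cjAct H
  have h1 : MulAction.stabilizer G ψ = H := by
    ext x
    rw [MulAction.mem_stabilizer_iff]
    change cj H ψ x⁻¹ = ψ ↔ _
    constructor
    · intro h; simpa using hst _ h
    · intro h; exact cj_mem H ψ _ (H.inv_mem h)
  have h2 := MulAction.index_stabilizer G ψ
  rw [h1] at h2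
  rw [h2, ← Nat.card_coe_set_eq]
  apply Nat.card_congr
  apply Equiv.subtypeEquivRight
  intro φ
  rw [MulAction.mem_orbit_iff]
  constructor
  · intro h
    obtain ⟨x, hx⟩ := ind_eq_conj H ψ φ hst h
    refine ⟨x⁻¹, ?_⟩
    change cj H ψ x⁻¹⁻¹ = φ
    rw [inv_inv, hx]
  · rintro ⟨x, rfl⟩
    exact ind_cj H ψ x⁻¹
end aux17b

section aux17c

open Classical in
theorem dual_sum {A : Type} [CommGroup A] [Fintype A] [Fintype (A →* ℂˣ)] (a : A) :
    ∑ ψ : A →* ℂˣ, ((ψ a : ℂˣ) : ℂ) = if a = 1 then (Nat.card A : ℂ) else 0 := by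
  have : HasEnoughRootsOfUnity ℂ (Monoid.exponent A) := by
    have : NeZero (Monoid.exponent A) := ⟨Monoid.exponent_ne_zero_of_finite⟩
    infer_instance
  have h := sum_hom_units ((Units.coeHom ℂ).comp (MonoidHom.eval a : (A →* ℂˣ) →* ℂˣ))
  change ∑ ψ : A →* ℂˣ, ((ψ a : ℂˣ) : ℂ) = _ at h
  rw [h, ← Nat.card_eq_fintype_card, CommGroup.card_monoidHom_of_hasEnoughRootsOfUnity]
  have h2 : ((Units.coeHom ℂ).comp (MonoidHom.eval a : (A →* ℂˣ) →* ℂˣ)) = 1 ↔ a = 1 := by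
    constructor
    · intro h
      by_contra ha
      obtain ⟨φ, hφ⟩ := CommGroup.exists_apply_ne_one_of_hasEnoughRootsOfUnity A ℂ ha
      apply hφ
      have : ((φ a : ℂˣ) : ℂ) = 1 := DFunLike.congr_fun h φ
      exact Units.val_injective this
    · rintro rfl
      ext φ
      simp
  simp only [h2]
  split_ifs <;> simp

theorem dual_card {A : Type} [CommGroup A] [Finite A] (K : Subgroup A) :
    Nat.card {ψ : A →* ℂ // ∃ a ∈ K, ψ a ≠ 1} + K.index = Nat.card A := by
  have : HasEnoughRootsOfUnity ℂ (Monoid.exponent A) := by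
    have : NeZero (Monoid.exponent A) := ⟨Monoid.exponent_ne_zero_of_finite⟩
    infer_instance
  let e : (A →* ℂ) ≃ (A →* ℂˣ) :=
    { toFun := fun f => f.toHomUnits
      invFun := fun f => (Units.coeHom ℂ).comp f
      left_inv := fun f => by ext; simp
      right_inv := fun f => by ext; simp }
  have h1 : Nat.card (A →* ℂ) = Nat.card A := by
    rw [Nat.card_congr e, CommGroup.card_monoidHom_of_hasEnoughRootsOfUnity]
  have hf : Finite (A →* ℂ) := Nat.finite_of_card_ne_zero (by rw [h1]; exact Nat.card_pos.ne')
  have h2 : Nat.card {ψ : A →* ℂ // ¬ ∃ a ∈ K, ψ a ≠ 1} = K.index := by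
    have := CommGroup.card_domRestrictHom_ker ℂ K
    rw [Subgroup.index, ← this]
    apply Nat.card_congr
    refine e.subtypeEquiv ?_
    intro ψ
    push Not
    rw [MonoidHom.mem_ker]
    constructor
    · intro h
      ext a
      simpa [e] using h a a.2
    · intro h a ha
      have := DFunLike.congr_fun h ⟨a, ha⟩
      have := congrArg (Units.val) this
      simpa [e] using this
  rw [← h2, ← h1]
  classical
  have := Fintype.ofFinite (A →* ℂ)
  rw [Nat.card_eq_fintype_card, Nat.card_eq_fintype_card, Nat.card_eq_fintype_card]
  rw [Fintype.card_subtype_compl]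
  have := Fintype.card_subtype_le (fun ψ : A →* ℂ => ∃ a ∈ K, ψ a ≠ 1)
  omega

open Classical in
theorem dual_sum' {A : Type} [I : Group A] [Fintype A] [F : Fintype (A →* ℂˣ)]
    (hc : ∀ a b : A, a * b = b * a) (a : A) :
    ∑ ψ : A →* ℂˣ, ((ψ a : ℂˣ) : ℂ) = if a = 1 then (Nat.card A : ℂ) else 0 :=
  @dual_sum A { I with mul_comm := hc } _ F a

theorem dual_card' {A : Type} [I : Group A] [Finite A] (hc : ∀ a b : A, a * b = b * a)
    (K : Subgroup A) :
    Nat.card {ψ : A →* ℂ // ∃ a ∈ K, ψ a ≠ 1} + K.index = Nat.card A :=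
  @dual_card A { I with mul_comm := hc } _ K

theorem dual_fin {A : Type} [CommGroup A] [Finite A] : Finite (A →* ℂˣ) := by
  have : HasEnoughRootsOfUnity ℂ (Monoid.exponent A) := by
    have : NeZero (Monoid.exponent A) := ⟨Monoid.exponent_ne_zero_of_finite⟩
    infer_instance
  exact Nat.finite_of_card_ne_zero (by
    rw [CommGroup.card_monoidHom_of_hasEnoughRootsOfUnity]; exact Nat.card_pos.ne')

theorem dual_fin' {A : Type} [I : Group A] [Finite A] (hc : ∀ a b : A, a * b = b * a) :
    Finite (A →* ℂˣ) :=
  @dual_fin A { I with mul_comm := hc } _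

variable {G : Type} [Group G] [Fintype G] (H : Subgroup G)

theorem linear_of_trivial (V : FDRep ℂ G) [Simple V]
    (h : ∀ z ∈ commutator G, V.ρ z = 1) : V.character 1 = 1 := by
  have hsc : ∀ g, ∃ c : ℂ, V.ρ g = c • 1 := by
    intro g
    let f : V ⟶ V := ⟨InducedCategory.homMk (ModuleCat.ofHom (V.ρ g)), by
      intro x
      ext w
      change V.ρ g (V.ρ x w) = V.ρ x (V.ρ g w)
      have h1 := h (g⁻¹ * x⁻¹ * g * x) (by
        have := Subgroup.commutator_mem_commutator (G := G) (H₁ := ⊤) (H₂ := ⊤)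
          (g₁ := g⁻¹) (g₂ := x⁻¹) trivial trivial
        simpa [commutatorElement_def, commutator_def] using this)
      have h2 : g * x = x * g * (g⁻¹ * x⁻¹ * g * x) := by simp [mul_assoc]
      rw [← Module.End.mul_apply, ← map_mul, h2, map_mul, h1, mul_one, map_mul]
      rfl⟩
    have hr := finrank_endomorphism_simple_eq_one ℂ V
    obtain ⟨c, hc⟩ := (finrank_eq_one_iff_of_nonzero' (𝟙 V) (id_nonzero V)).mp hr f
    refine ⟨c, ?_⟩
    have := congrArg (fun f : V ⟶ V => f.hom.hom.hom) hc
    exact this.symm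
  have hn := (FDRep.simple_iff_char_is_norm_one V).mp inferInstance
  choose c hc using hsc
  have hg : ∀ g, V.character g = c g * V.character 1 := by
    intro g
    rw [FDRep.character, FDRep.character, hc g, map_one, map_smul, smul_eq_mul]
  have h0 : V.character 1 ≠ 0 := by
    intro h0
    rw [Finset.sum_eq_zero] at hn
    · have : (Nat.card G : ℂ) ≠ 0 := by exact_mod_cast Nat.card_pos.ne'
      exact this hn.symm
    · intro g _; rw [hg, h0]; simp
  have hcc : ∀ g, c g * c g⁻¹ = 1 := by
    intro g
    have h1 : V.ρ g * V.ρ g⁻¹ = 1 := by rw [← map_mul]; simp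
    have h2 := congrArg (LinearMap.trace ℂ V) h1
    rw [hc g, hc g⁻¹, smul_mul_smul_comm, mul_one, map_smul, smul_eq_mul] at h2
    have h3 : LinearMap.trace ℂ V 1 = V.character 1 := by
      rw [FDRep.character, map_one V.ρ]
    rw [h3] at h2
    exact mul_right_cancel₀ h0 (by rw [h2, one_mul])
  have hs : ∀ g, V.character g * V.character g⁻¹ = V.character 1 * V.character 1 := by
    intro g
    rw [hg g, hg g⁻¹, mul_mul_mul_comm, hcc, one_mul]
  rw [Finset.sum_congr rfl fun g _ => hs g] at hn
  have hd : V.character 1 * V.character 1 = 1 := by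
    have : (Fintype.card G : ℂ) ≠ 0 := by exact_mod_cast Fintype.card_ne_zero
    rw [Finset.sum_const, Finset.card_univ, nsmul_eq_mul, Nat.card_eq_fintype_card] at hn
    exact mul_left_cancel₀ this (by rw [hn, mul_one])
  rw [FDRep.char_one] at hd ⊢
  have : Module.finrank ℂ V * Module.finrank ℂ V = 1 := by exact_mod_cast hd
  have := Nat.eq_one_of_mul_eq_one_right this
  rw [this]; simp

theorem exists_ψ [IsMulCommutative ↥H] (hK : commutator G ≤ H) (V : FDRep ℂ G) [Simple V]
    (h1 : V.character 1 ≠ 1) :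
    ∃ ψ : ↥H →* ℂ, (∃ h : ↥H, (h : G) ∈ commutator G ∧ ψ h ≠ 1) ∧
      ∃ f : V ⟶ indR H ψ, f ≠ 0 := by
  classical
  have hc : ∀ a b : ↥H, a * b = b * a := fun a b => mul_comm' a b
  have : Finite (↥H →* ℂˣ) := dual_fin' hc
  have := Fintype.ofFinite (↥H →* ℂˣ)
  let E : (↥H →* ℂˣ) → (V →ₗ[ℂ] V) := fun ψ => ∑ h : ↥H, ((ψ h⁻¹ : ℂˣ) : ℂ) • V.ρ h
  have hE1 : ∀ ψ (k : ↥H), E ψ * V.ρ k = ((ψ k : ℂˣ) : ℂ) • E ψ := by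
    intro ψ k
    simp only [E, Finset.sum_mul, Finset.smul_sum]
    refine Fintype.sum_equiv (Equiv.mulRight k) _ _ ?_
    intro h
    simp only [Equiv.coe_mulRight, mul_inv_rev, smul_smul, smul_mul_assoc, Subgroup.coe_mul,
      map_mul]
    congr 1
    rw [Units.val_mul, ← mul_assoc, ← Units.val_mul, ← map_mul]; simp
  have hE2 : ∑ ψ, E ψ = (Nat.card ↥H : ℂ) • 1 := by
    simp only [E]
    rw [Finset.sum_comm]
    simp only [← Finset.sum_smul]
    have : ∀ h : ↥H, ∑ ψ : ↥H →* ℂˣ, ((ψ h⁻¹ : ℂˣ) : ℂ) = if h⁻¹ = 1 then (Nat.card ↥H : ℂ) else 0 :=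
      fun h => by convert dual_sum' hc h⁻¹
    rw [Finset.sum_congr rfl fun h _ => by rw [this h]]
    simp
  by_cases hex : ∃ ψ : ↥H →* ℂˣ, (∃ h : ↥H, (h : G) ∈ commutator G ∧ ψ h ≠ 1) ∧ E ψ ≠ 0
  · obtain ⟨ψ, ⟨h, hh, hne⟩, hE⟩ := hex
    refine ⟨(Units.coeHom ℂ).comp ψ, ⟨h, hh, ?_⟩, ?_⟩
    · simpa using hne
    · obtain ⟨v, hv⟩ : ∃ v, E ψ v ≠ 0 := by
        by_contra! hc
        exact hE (LinearMap.ext hc)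
      obtain ⟨f, hf⟩ : ∃ f : Module.Dual ℂ V, f (E ψ v) ≠ 0 := by
        by_contra! hc
        exact hv ((Module.forall_dual_apply_eq_zero_iff ℂ _).mp hc)
      refine exists_hom_indR H _ V (f ∘ₗ E ψ) ?_ v hf
      intro k w
      have := LinearMap.congr_fun (hE1 ψ k) w
      simp only [Module.End.mul_apply, LinearMap.smul_apply] at this
      simp [this]
  · exfalso
    push Not at hex
    apply h1
    apply linear_of_trivial
    intro z hz
    have h0 : (Nat.card ↥H : ℂ) ≠ 0 := by exact_mod_cast Nat.card_pos.ne'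
    have h2 : (∑ ψ, E ψ) * V.ρ z = ∑ ψ, E ψ := by
      rw [Finset.sum_mul]
      refine Finset.sum_congr rfl fun ψ _ => ?_
      have := hE1 ψ ⟨z, hK hz⟩
      rw [this]
      by_cases hz1 : ψ ⟨z, hK hz⟩ = 1
      · simp [hz1]
      · rw [hex ψ ⟨⟨z, hK hz⟩, hz, hz1⟩]; simp
    rw [hE2, smul_mul_assoc, one_mul] at h2
    exact smul_right_injective _ h0 h2
end aux17c

section aux17d
variable {G : Type} [Group G] [Fintype G] (H : Subgroup G)

theorem top_of_le {p : ℕ} (hp : p.Prime) (hidx : H.index = p) (K : Subgroup G) (hK : H ≤ K)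
    (t : G) (ht : t ∉ H) (htK : t ∈ K) : K = ⊤ := by
  have h1 := Subgroup.index_dvd_of_le hK
  rw [hidx, Nat.dvd_prime hp] at h1
  rcases h1 with h1 | h1
  · exact Subgroup.index_eq_one.mp h1
  · exfalso
    have h2 := H.card_mul_index
    have h3 := K.card_mul_index
    rw [hidx] at h2
    rw [h1, ← h2] at h3
    have h4 : Nat.card K = Nat.card H := Nat.eq_of_mul_eq_mul_right hp.pos h3
    have h5 : H = K := Subgroup.eq_of_le_of_card_ge hK h4.le
    exact ht (h5 ▸ htK)

theorem comm_le_s17 {p : ℕ} (hp : p.Prime) (hidx : H.index = p) [H.Normal] : commutator G ≤ H := by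
  rw [← Subgroup.Normal.quotient_commutative_iff_commutator_le]
  have : Fact p.Prime := ⟨hp⟩
  have : IsCyclic (G ⧸ H) := isCyclic_of_prime_card (p := p) hidx
  infer_instance

/-- the commutator map -/
def dlt [hn : H.Normal] (hHab : ∀ x ∈ H, ∀ y ∈ H, x * y = y * x) (t : G) : ↥H →* G where
  toFun h := t * h * t⁻¹ * (h : G)⁻¹
  map_one' := by simp
  map_mul' a b := by
    have h1 := hHab _ (H.inv_mem a.2) _ (hn.conj_mem _ b.2 t)
    have h2 := hHab _ (H.inv_mem a.2) _ (H.inv_mem b.2)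
    calc t * ((a * b : ↥H) : G) * t⁻¹ * ((a * b : ↥H) : G)⁻¹
        = t * a * t⁻¹ * (t * b * t⁻¹) * ((b : G)⁻¹ * (a : G)⁻¹) := by simp [mul_assoc]
      _ = t * a * t⁻¹ * ((t * b * t⁻¹) * (a : G)⁻¹) * (b : G)⁻¹ := by
          rw [← h2]; simp only [mul_assoc]
      _ = _ := by rw [← h1]; simp only [mul_assoc]

theorem dlt_apply [hn : H.Normal] (hHab : ∀ x ∈ H, ∀ y ∈ H, x * y = y * x) (t : G) (h : ↥H) :
    dlt H hHab t h = t * h * t⁻¹ * (h : G)⁻¹ := rfl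

theorem dlt_range {p : ℕ} (hp : p.Prime) (hidx : H.index = p) [hn : H.Normal]
    (hHab : ∀ x ∈ H, ∀ y ∈ H, x * y = y * x) (t : G) (ht : t ∉ H) :
    (dlt H hHab t).range = commutator G := by
  set R := (dlt H hHab t).range with hR
  have hRH : R ≤ H := by
    rintro _ ⟨h, rfl⟩
    exact H.mul_mem (hn.conj_mem _ h.2 t) (H.inv_mem h.2)
  let S : Subgroup G :=
    { carrier := {g | ∀ h ∈ H, g * h * g⁻¹ * h⁻¹ ∈ R}
      one_mem' := by intro h _; simp
      mul_mem' := by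
        intro a b ha hb h hh
        have h1 := R.mul_mem (ha _ (hn.conj_mem _ hh b)) (hb h hh)
        simpa [mul_assoc] using h1
      inv_mem' := by
        intro a ha h hh
        have h1 := R.inv_mem (ha _ (hn.conj_mem _ hh a⁻¹))
        simpa [mul_assoc] using h1 }
  have hS : S = ⊤ := by
    apply top_of_le H hp hidx S _ t ht
    · intro h hh
      exact ⟨⟨h, hh⟩, rfl⟩
    · intro g hg h hh
      rw [hHab g hg h hh]; simp
  have hS' : ∀ g, ∀ h ∈ H, g * h * g⁻¹ * h⁻¹ ∈ R := by
    intro g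
    have : g ∈ S := by rw [hS]; trivial
    exact this
  have hRn : R.Normal := ⟨by
    intro r hr g
    have := R.mul_mem (hS' g r (hRH hr)) hr
    simpa using this⟩
  apply le_antisymm
  · rintro _ ⟨h, rfl⟩
    have := Subgroup.commutator_mem_commutator (G := G) (H₁ := ⊤) (H₂ := ⊤)
      (g₁ := t) (g₂ := (h : G)) trivial trivial
    simpa [commutatorElement_def, commutator_def, dlt_apply] using this
  · rw [← Subgroup.Normal.quotient_commutative_iff_commutator_le]
    let C : G → Subgroup G := fun g =>
      (Subgroup.centralizer {(QuotientGroup.mk' R) g}).comap (QuotientGroup.mk' R)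
    have hC : ∀ g x, x ∈ C g ↔ (QuotientGroup.mk' R) x * (QuotientGroup.mk' R) g =
        (QuotientGroup.mk' R) g * (QuotientGroup.mk' R) x := by
      intro g x
      simp only [C, Subgroup.mem_comap, Subgroup.mem_centralizer_singleton_iff]
    have hCH : ∀ g, H ≤ C g := by
      intro g h hh
      rw [hC, ← map_mul, ← map_mul, eq_comm, ← div_eq_one, ← map_div]
      have := hS' g h hh
      rw [← QuotientGroup.ker_mk' R, MonoidHom.mem_ker] at this
      rw [← this]
      simp [div_eq_mul_inv, mul_assoc]
    have hCt : C t = ⊤ := top_of_le H hp hidx _ (hCH t) t ht (by rw [hC])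
    have hCg : ∀ g, C g = ⊤ := fun g => top_of_le H hp hidx _ (hCH g) t ht (by
      have : g ∈ C t := by rw [hCt]; trivial
      rw [hC] at this ⊢
      exact this.symm)
    refine ⟨⟨?_⟩⟩
    intro a b
    obtain ⟨a, rfl⟩ := QuotientGroup.mk'_surjective R a
    obtain ⟨b, rfl⟩ := QuotientGroup.mk'_surjective R b
    rw [← hC, hCg]; trivial

theorem comm_card {p : ℕ} (hp : p.Prime) (hcard : Fintype.card G = p ^ 4)
    (hnab : ¬ ∀ a b : G, a * b = b * a)
    [Group.IsNilpotent G] (hclass : Group.nilpotencyClass G = 3)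
    (hHab : ∀ x ∈ H, ∀ y ∈ H, x * y = y * x) [hn : H.Normal]
    (hidx : H.index = p) (t : G) (ht : t ∉ H) : Nat.card (commutator G) = p ^ 2 := by
  have hf : Fact p.Prime := ⟨hp⟩
  have hcG : Nat.card G = p ^ 4 := by rw [Nat.card_eq_fintype_card, hcard]
  have hcomm : ∀ x, t * x = x * t → (∀ h ∈ H, h * x = x * h) → x ∈ Subgroup.center G := by
    intro x h1 h2
    have := top_of_le H hp hidx (Subgroup.centralizer {x}) (by
      intro h hh
      rw [Subgroup.mem_centralizer_singleton_iff]; exact h2 h hh) t ht (by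
        rw [Subgroup.mem_centralizer_singleton_iff]; exact h1)
    rw [Subgroup.mem_center_iff]
    intro g
    have hg : g ∈ Subgroup.centralizer {x} := by rw [this]; trivial
    rwa [Subgroup.mem_centralizer_singleton_iff] at hg
  have hZH : Subgroup.center G ≤ H := by
    intro z hz
    by_contra hzH
    rw [Subgroup.mem_center_iff] at hz
    have h1 : Subgroup.centralizer (H : Set G) = ⊤ :=
      top_of_le H hp hidx _ (fun h hh => by
        rw [Subgroup.mem_centralizer_iff]
        intro k hk
        exact hHab k hk h hh) z hzH (by
          rw [Subgroup.mem_centralizer_iff]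
          intro k _
          exact hz k)
    have h2 : H ≤ Subgroup.center G := by
      intro h hh
      rw [Subgroup.mem_center_iff]
      intro g
      have hg : g ∈ Subgroup.centralizer (H : Set G) := by rw [h1]; trivial
      rw [Subgroup.mem_centralizer_iff] at hg
      exact (hg h hh).symm
    have h3 := top_of_le H hp hidx _ h2 z hzH (by rw [Subgroup.mem_center_iff]; exact hz)
    apply hnab
    intro a b
    have : b ∈ Subgroup.center G := by rw [h3]; trivial
    rw [Subgroup.mem_center_iff] at this
    exact this a
  have hker : (dlt H hHab t).ker = (Subgroup.center G).subgroupOf H := by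
    ext h
    rw [MonoidHom.mem_ker, Subgroup.mem_subgroupOf, dlt_apply]
    constructor
    · intro h1
      apply hcomm
      · exact mul_inv_eq_iff_eq_mul.mp (mul_inv_eq_one.mp h1)
      · intro k hk; exact hHab k hk h h.2
    · intro h1
      rw [Subgroup.mem_center_iff] at h1
      rw [h1 t]; simp
  have hncomm : ¬ IsMulCommutative (G ⧸ Subgroup.center G) := by
    intro hc
    have h1 := Group.IsNilpotent.nilpotencyClass_le_one_iff.mpr hc
    rw [Group.nilpotencyClass_quotient_center, hclass] at h1
    omega
  have hZ : Nat.card (Subgroup.center G) = p := by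
    obtain ⟨k, hk, hk2⟩ := (Nat.dvd_prime_pow hp).mp (hcG ▸ Subgroup.card_subgroup_dvd_card
      (Subgroup.center G))
    have hq := (Subgroup.center G).card_mul_index
    rw [hcG, hk2] at hq
    have hi : (Subgroup.center G).index = p ^ (4 - k) := by
      have : p ^ k * p ^ (4 - k) = p ^ 4 := by rw [← pow_add]; congr 1; omega
      exact Nat.eq_of_mul_eq_mul_left (pow_pos hp.pos k) (hq.trans this.symm)
    have hG : IsPGroup p G := IsPGroup.of_card hcG
    have : Nontrivial G := by
      rw [← Finite.one_lt_card_iff_nontrivial, hcG]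
      exact Nat.one_lt_pow (by norm_num) hp.one_lt
    have hnt := hG.center_nontrivial
    interval_cases k
    · rw [← Finite.one_lt_card_iff_nontrivial, hk2] at hnt
      simp at hnt
    · simpa using hk2
    · exact absurd (IsPGroup.isMulCommutative_of_card_eq_prime_sq (p := p) hi) hncomm
    · have : IsCyclic (G ⧸ Subgroup.center G) := isCyclic_of_prime_card (p := p) (hi.trans (pow_one p))
      exact (hncomm inferInstance).elim
    · have : IsCyclic (G ⧸ Subgroup.center G) := by
        have : Subsingleton (G ⧸ Subgroup.center G) := by
          have : Nat.card (G ⧸ Subgroup.center G) = 1 := hi.trans (pow_zero p)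
          exact (Nat.card_eq_one_iff_unique.mp this).1
        infer_instance
      exact (hncomm inferInstance).elim
  have h1 := (dlt H hHab t).ker.card_mul_index
  rw [Subgroup.index_ker, dlt_range H hp hidx hHab t ht, hker,
    Nat.card_congr (Subgroup.subgroupOfEquivOfLe hZH).toEquiv, hZ] at h1
  have h2 := H.card_mul_index
  rw [hcG, hidx, ← h1] at h2
  have h3 : p * p * Nat.card (commutator G) = p * p * p ^ 2 := by
    calc _ = p * Nat.card (commutator G) * p := by ring
      _ = p ^ 4 := h2
      _ = _ := by ring
  exact Nat.eq_of_mul_eq_mul_left (Nat.mul_pos hp.pos hp.pos) h3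

end aux17d

/-- Let `G` be a non-abelian group of order `p^4` of nilpotency class `3` and `H` its
(unique) abelian subgroup of index `p`.  Every `ψ ∈ Irr(H)` with `G' ⊄ ker ψ` induces a
non-linear irreducible character of `G`; conversely every non-linear irreducible character
of `G` is induced from such a `ψ`; each non-linear character arises from exactly `p` such
`ψ`; and `G` has exactly `p² - 1` non-linear irreducible characters. -/
theorem stmt17 {p : ℕ} (hp : p.Prime) {G : Type} [Group G] [Fintype G]
    (hcard : Fintype.card G = p ^ 4)
    (hnab : ¬ ∀ a b : G, a * b = b * a)
    [Group.IsNilpotent G] (hclass : Group.nilpotencyClass G = 3)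
    (H : Subgroup G) (hHab : ∀ x ∈ H, ∀ y ∈ H, x * y = y * x)
    (hHidx : H.index = p) :
    (∀ ψ : ↥H →* ℂ, (∃ h : ↥H, (h : G) ∈ commutator G ∧ ψ h ≠ 1) →
        IsIrrChar G (inducedChar H ⇑ψ) ∧ inducedChar H ⇑ψ 1 ≠ 1) ∧
    (∀ χ : G → ℂ, IsIrrChar G χ → χ 1 ≠ 1 →
        ∃ ψ : ↥H →* ℂ, (∃ h : ↥H, (h : G) ∈ commutator G ∧ ψ h ≠ 1) ∧
          inducedChar H ⇑ψ = χ) ∧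
    (∀ χ : G → ℂ, IsIrrChar G χ → χ 1 ≠ 1 →
        Nat.card {ψ : ↥H →* ℂ //
          (∃ h : ↥H, (h : G) ∈ commutator G ∧ ψ h ≠ 1) ∧ inducedChar H ⇑ψ = χ} = p) ∧
    Nat.card {χ : G → ℂ // IsIrrChar G χ ∧ χ 1 ≠ 1} = p ^ 2 - 1 := by
  have hf : Fact p.Prime := ⟨hp⟩
  have hcG : Nat.card G = p ^ 4 := by rw [Nat.card_eq_fintype_card, hcard]
  have hn : H.Normal := by
    apply Subgroup.normal_of_index_eq_minFac_card
    rw [hHidx, hcG, hp.pow_minFac (by norm_num)]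
  have hM : IsMulCommutative ↥H := ⟨⟨fun a b => Subtype.ext (hHab a a.2 b b.2)⟩⟩
  have hc : ∀ a b : ↥H, a * b = b * a := fun a b => Subtype.ext (hHab a a.2 b b.2)
  have hKH := comm_le_s17 H hp hHidx
  obtain ⟨t, ht⟩ : ∃ t, t ∉ H := by
    by_contra! h
    have : H = ⊤ := by ext x; simp [h x]
    rw [this, Subgroup.index_top] at hHidx
    exact hp.one_lt.ne hHidx
  have hst : ∀ ψ : ↥H →* ℂ, (∃ h : ↥H, (h : G) ∈ commutator G ∧ ψ h ≠ 1) →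
      ∀ x, cj H ψ x = ψ → x ∈ H := by
    rintro ψ ⟨h, hh, hne⟩ x hx
    by_contra hxH
    apply hne
    rw [← dlt_range H hp hHidx hHab x hxH] at hh
    obtain ⟨k, hk⟩ := hh
    have h1 : h = MulAut.conjNormal x k * k⁻¹ := by
      ext
      rw [← hk, dlt_apply]; simp
    have h2 := DFunLike.congr_fun hx k
    rw [cj_apply] at h2
    rw [h1, map_mul, h2, ← map_mul]; simp
  have P1 : ∀ ψ : ↥H →* ℂ, (∃ h : ↥H, (h : G) ∈ commutator G ∧ ψ h ≠ 1) →
        IsIrrChar G (inducedChar H ⇑ψ) ∧ inducedChar H ⇑ψ 1 ≠ 1 := by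
    intro ψ hψ
    refine ⟨⟨indR H ψ, ind_simple H ψ (hst ψ hψ), indR_char H ψ⟩, ?_⟩
    rw [ind_one, hHidx]
    exact_mod_cast hp.one_lt.ne'
  have P2 : ∀ χ : G → ℂ, IsIrrChar G χ → χ 1 ≠ 1 →
        ∃ ψ : ↥H →* ℂ, (∃ h : ↥H, (h : G) ∈ commutator G ∧ ψ h ≠ 1) ∧
          inducedChar H ⇑ψ = χ := by
    rintro χ ⟨V, hV, rfl⟩ h1
    obtain ⟨ψ, hψ, f, hf0⟩ := exists_ψ H hKH V h1
    refine ⟨ψ, hψ, ?_⟩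
    have := ind_simple H ψ (hst ψ hψ)
    have := isIso_of_hom_simple hf0
    rw [← indR_char]
    exact (FDRep.char_iso (asIso f)).symm
  have P3 : ∀ χ : G → ℂ, IsIrrChar G χ → χ 1 ≠ 1 →
        Nat.card {ψ : ↥H →* ℂ //
          (∃ h : ↥H, (h : G) ∈ commutator G ∧ ψ h ≠ 1) ∧ inducedChar H ⇑ψ = χ} = p := by
    intro χ hχ h1
    obtain ⟨ψ, hψ, rfl⟩ := P2 χ hχ h1
    rw [← hHidx, ← fibre_card H ψ (hst ψ hψ)]
    apply Nat.card_congr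
    apply Equiv.subtypeEquivRight
    intro φ
    refine ⟨fun h => h.2, fun h => ⟨?_, h⟩⟩
    obtain ⟨x, rfl⟩ := ind_eq_conj H ψ φ (hst ψ hψ) h
    obtain ⟨k, hk, hne⟩ := hψ
    refine ⟨MulAut.conjNormal x⁻¹ k, ?_, ?_⟩
    · rw [MulAut.conjNormal_apply]
      exact Subgroup.Normal.conj_mem inferInstance _ hk _
    · rw [cj_apply]
      simpa using hne
  refine ⟨P1, P2, P3, ?_⟩
  have hKc := comm_card H hp hcard hnab hclass hHab hHidx t ht
  have hHc : Nat.card ↥H = p ^ 3 := by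
    have := H.card_mul_index
    rw [hcG, hHidx] at this
    exact Nat.eq_of_mul_eq_mul_right hp.pos (by rw [this]; ring)
  have hKi : ((commutator G).subgroupOf H).index = p := by
    have := ((commutator G).subgroupOf H).card_mul_index
    rw [Nat.card_congr (Subgroup.subgroupOfEquivOfLe hKH).toEquiv, hKc, hHc] at this
    exact Nat.eq_of_mul_eq_mul_left (pow_pos hp.pos 2) (by rw [this]; ring)
  have hI := dual_card' hc ((commutator G).subgroupOf H)
  rw [hKi, hHc] at hI
  let e : {ψ : ↥H →* ℂ // ∃ a ∈ (commutator G).subgroupOf H, ψ a ≠ 1} ≃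
      Σ χ : {χ : G → ℂ // IsIrrChar G χ ∧ χ 1 ≠ 1}, {ψ : ↥H →* ℂ //
          (∃ h : ↥H, (h : G) ∈ commutator G ∧ ψ h ≠ 1) ∧ inducedChar H ⇑ψ = χ.1} :=
    { toFun := fun ψ => ⟨⟨inducedChar H ψ.1, P1 ψ.1 ψ.2⟩, ⟨ψ.1, ψ.2, rfl⟩⟩
      invFun := fun s => ⟨s.2.1, s.2.2.1⟩
      left_inv := fun ψ => rfl
      right_inv := by
        rintro ⟨⟨χ, hχ⟩, ⟨ψ, hψ, h⟩⟩
        dsimp only at h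
        subst h
        rfl }
  have hfin : Finite {ψ : ↥H →* ℂ // ∃ a ∈ (commutator G).subgroupOf H, ψ a ≠ 1} := by
    apply Nat.finite_of_card_ne_zero
    intro h0
    rw [h0, zero_add] at hI
    have h2 : p ^ 1 < p ^ 3 := Nat.pow_lt_pow_right hp.one_lt (by norm_num)
    rw [pow_one] at h2
    omega
  have hfs : Finite {χ : G → ℂ // IsIrrChar G χ ∧ χ 1 ≠ 1} := by
    apply Finite.of_surjective (fun ψ : {ψ : ↥H →* ℂ //
      ∃ a ∈ (commutator G).subgroupOf H, ψ a ≠ 1} =>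
        (⟨inducedChar H ψ.1, P1 ψ.1 ψ.2⟩ : {χ : G → ℂ // IsIrrChar G χ ∧ χ 1 ≠ 1}))
    rintro ⟨χ, h1, h2⟩
    obtain ⟨ψ, hψ, h⟩ := P2 χ h1 h2
    exact ⟨⟨ψ, hψ⟩, Subtype.ext h⟩
  have hfs2 := Fintype.ofFinite {χ : G → ℂ // IsIrrChar G χ ∧ χ 1 ≠ 1}
  have hff : ∀ χ : {χ : G → ℂ // IsIrrChar G χ ∧ χ 1 ≠ 1}, Finite {ψ : ↥H →* ℂ //
          (∃ h : ↥H, (h : G) ∈ commutator G ∧ ψ h ≠ 1) ∧ inducedChar H ⇑ψ = χ.1} := by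
    intro χ
    apply Nat.finite_of_card_ne_zero
    rw [P3 χ.1 χ.2.1 χ.2.2]
    exact hp.ne_zero
  rw [Nat.card_congr e, Nat.card_sigma,
    Finset.sum_congr rfl fun χ _ => P3 χ.1 χ.2.1 χ.2.2, Finset.sum_const, Finset.card_univ,
    ← Nat.card_eq_fintype_card, smul_eq_mul] at hI
  have h4 : (Nat.card {χ : G → ℂ // IsIrrChar G χ ∧ χ 1 ≠ 1} + 1) * p = p ^ 2 * p := by
    rw [add_mul, one_mul, hI]; ring
  have h5 := Nat.eq_of_mul_eq_mul_right hp.pos h4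
  omega
end
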